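/- Let X ⊂ P^4 be a nodal hypersurface of degree d ≥ 3 with defect and exactly (d-1)^2 nodes. Then X contains a plane (a 2-dimensional linear subspace of P^4). -/

import Mathlib

open MvPolynomial

attribute [local instance] MvPolynomial.gradedAlgebra

/-- Hilbert function. -/
noncomputable def hilb (m : ℕ) (I : Ideal (MvPolynomial (Fin m) ℂ)) (k : ℕ) : ℕ :=
  Module.finrank ℂ
    (↥(homogeneousSubmodule (Fin m) ℂ k) ⧸
      Submodule.comap (homogeneousSubmodule (Fin m) ℂ k).subtype (Submodule.restrictScalars ℂ I))

/-- The Hessian matrix of second partial derivatives of `f`, evaluated at `x`. -/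
noncomputable def hessian (m : ℕ) (f : MvPolynomial (Fin m) ℂ) (x : Fin m → ℂ) :
    Matrix (Fin m) (Fin m) ℂ :=
  Matrix.of fun i j => MvPolynomial.eval x (pderiv i (pderiv j f))

/-- The singular locus of `V(f)` in `ℙ^{m-1}`. -/
def singLocus (m : ℕ) (f : MvPolynomial (Fin m) ℂ) : Set (Projectivization ℂ (Fin m → ℂ)) :=
  {p | ∀ i, MvPolynomial.eval p.rep (pderiv i f) = 0}

/-- `V(f)` is nodal: at every singular point the (homogeneous) Hessian has corank one,
i.e. the singularity is an ordinary double point. -/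
def IsNodal (m : ℕ) (f : MvPolynomial (Fin m) ℂ) : Prop :=
  ∀ x : Fin m → ℂ, x ≠ 0 → (∀ i, MvPolynomial.eval x (pderiv i f) = 0) →
    (hessian m f x).rank = m - 1

/-- The homogeneous vanishing ideal of a set of points of `ℙ^{m-1}`
(polynomials vanishing on the affine cone). -/
noncomputable def coneVanishingIdeal (m : ℕ) (Sig : Set (Projectivization ℂ (Fin m → ℂ))) :
    Ideal (MvPolynomial (Fin m) ℂ) :=
  Ideal.span {g | ∀ p ∈ Sig, ∀ t : ℂ, MvPolynomial.eval (t • p.rep) g = 0}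

/-- A commuting family of endomorphisms of a nonzero finite-dimensional complex vector space has
a common eigenvector. -/
theorem exists_common_eigenvector {ι : Type*} (n : ℕ) :
    ∀ {V : Type*} [AddCommGroup V] [Module ℂ V] [FiniteDimensional ℂ V] [Nontrivial V]
      (f : ι → Module.End ℂ V), (∀ i j, Commute (f i) (f j)) → Module.finrank ℂ V = n →
      ∃ v : V, v ≠ 0 ∧ ∀ i, ∃ μ : ℂ, f i v = μ • v := by
  induction n using Nat.strong_induction_on with
  | _ n ih =>
    intro V _ _ _ _ f hf hn
    by_cases h : ∃ i, ∀ μ : ℂ, (f i).eigenspace μ ≠ ⊤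
    · obtain ⟨i, hi⟩ := h
      obtain ⟨μ, hμ⟩ := Module.End.exists_eigenvalue (f i)
      have hinv : ∀ j, ∀ x ∈ (f i).eigenspace μ, f j x ∈ (f i).eigenspace μ := by
        intro j x hx
        rw [Module.End.mem_eigenspace_iff] at hx ⊢
        have := congrArg (fun g : Module.End ℂ V => g x) (hf i j)
        simp only [Module.End.mul_apply] at this
        rw [this, hx, map_smul]
      have hlt : Module.finrank ℂ ((f i).eigenspace μ) < n := by
        rw [← hn]
        exact Submodule.finrank_lt (hi μ)
      have : Nontrivial ((f i).eigenspace μ) := Submodule.nontrivial_iff_ne_bot.mpr hμ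
      obtain ⟨v, hv, hv'⟩ := ih _ hlt (fun j => (f j).restrict (hinv j))
        (fun j k => by
          ext x
          have := congrArg (fun g : Module.End ℂ V => g x) (hf j k)
          simpa using this) rfl
      refine ⟨v, by simpa using hv, fun j => ?_⟩
      obtain ⟨ν, hν⟩ := hv' j
      exact ⟨ν, by simpa using congrArg Subtype.val hν⟩
    · push Not at h
      obtain ⟨v, hv⟩ := exists_ne (0 : V)
      refine ⟨v, hv, fun i => ?_⟩
      obtain ⟨μ, hμ⟩ := h i
      exact ⟨μ, Module.End.mem_eigenspace_iff.mp (hμ ▸ Submodule.mem_top)⟩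

/-- The rank of a bilinear pairing can be computed on either side. -/
theorem finrank_range_flip {K X Y : Type*} [Field K] [AddCommGroup X] [Module K X]
    [AddCommGroup Y] [Module K Y] [FiniteDimensional K X] [FiniteDimensional K Y]
    (B : X →ₗ[K] Y →ₗ[K] K) :
    Module.finrank K (LinearMap.range B.flip) = Module.finrank K (LinearMap.range B) := by
  have h : B.flip = B.dualMap ∘ₗ (Module.evalEquiv K Y : Y →ₗ[K] Module.Dual K (Module.Dual K Y)) := by
    ext y x
    simp
  rw [h, LinearMap.range_comp_of_range_eq_top _ (LinearEquiv.range _)]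
  exact LinearMap.finrank_range_dualMap_eq_finrank_range B

open Polynomial in
/-- If every member of the pencil `A + a B` is singular, then the pencil has a polynomial null
vector; its coefficients are the sequence `F`. -/
theorem Matrix.exists_pencil_chain {K m n : Type*} [Field K] [Infinite K] [Fintype m] [Fintype n]
    [DecidableEq m] [DecidableEq n]
    (A B : Matrix m n K) (h : ∀ a : K, ∃ v : n → K, v ≠ 0 ∧ (A + a • B).mulVec v = 0) :
    ∃ F : ℕ → n → K, F 0 ≠ 0 ∧ A.mulVec (F 0) = 0 ∧
      ∀ i, A.mulVec (F (i + 1)) = - B.mulVec (F i) := by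
  let P : Matrix m n K[X] := A.map Polynomial.C + (Polynomial.X : K[X]) • B.map Polynomial.C
  let L := FractionRing K[X]
  have key : ∃ v : n → K[X], v ≠ 0 ∧ P.mulVec v = 0 := by
    let PL : Matrix m n L := P.map (algebraMap K[X] L)
    by_cases hinj : LinearMap.ker PL.mulVecLin = ⊥
    · exfalso
      obtain ⟨G, hG⟩ := LinearMap.exists_leftInverse_of_injective _ hinj
      let R : Matrix n m L := LinearMap.toMatrix' G
      have hR : R * PL = 1 := by
        apply Matrix.toLin'.injective
        rw [Matrix.toLin'_mul, Matrix.toLin'_toMatrix', Matrix.toLin'_one]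
        exact hG
      obtain ⟨b, hb⟩ := IsLocalization.exist_integer_multiples_of_finite (nonZeroDivisors K[X])
        (fun ij : n × m => R ij.1 ij.2)
      choose r hr using hb
      have hRP : (Matrix.of fun i j => r (i, j)) * P = (b : K[X]) • (1 : Matrix n n K[X]) := by
        apply Matrix.map_injective (IsFractionRing.injective K[X] L)
        dsimp only
        rw [Matrix.map_mul]
        have h1 : (Matrix.of fun i j => r (i, j)).map (algebraMap K[X] L) = (b : K[X]) • R := by
          ext i j
          exact hr (i, j)
        rw [h1]
        change ((b : K[X]) • R) * PL = _
        rw [Matrix.smul_mul, hR]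
        ext i j
        by_cases hij : i = j
        · subst hij; simp [Algebra.smul_def, Matrix.algebraMap_matrix_apply]
        · simp [hij]
      have hb0 : (b : K[X]) ≠ 0 := nonZeroDivisors.coe_ne_zero b
      obtain ⟨a, ha⟩ : ∃ a, (b : K[X]).eval a ≠ 0 := by
        by_contra! hcon
        exact hb0 (Polynomial.funext (by simpa using hcon))
      obtain ⟨v, hv, hv0⟩ := h a
      have h2 := congrArg (fun M : Matrix n n K[X] => (M.map (evalRingHom a)).mulVec v) hRP
      rw [Matrix.map_mul, ← Matrix.mulVec_mulVec] at h2
      have h3 : P.map (evalRingHom a) = A + a • B := by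
        ext i j
        simp [P, mul_comm a]
      have h4 : ((b : K[X]) • (1 : Matrix n n K[X])).map (evalRingHom a) =
          (b : K[X]).eval a • (1 : Matrix n n K) := by
        ext i j
        by_cases hij : i = j
        · subst hij; simp
        · simp [hij]
      rw [h3, hv0, Matrix.mulVec_zero, h4, Matrix.smul_mulVec, Matrix.one_mulVec] at h2
      exact (smul_ne_zero ha hv) h2.symm
    · obtain ⟨w, hw, hw0⟩ := Submodule.exists_mem_ne_zero_of_ne_bot hinj
      obtain ⟨b, hb⟩ := IsLocalization.exist_integer_multiples_of_finite (nonZeroDivisors K[X]) w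
      choose v hv using hb
      have hvw : (fun i => algebraMap K[X] L (v i)) = (b : K[X]) • w := by
        ext i; exact hv i
      refine ⟨v, ?_, ?_⟩
      · rintro rfl
        have : (b : K[X]) • w = 0 := by rw [← hvw]; ext; simp
        have hb0 : (b : K[X]) ≠ 0 := nonZeroDivisors.coe_ne_zero b
        apply hw0
        ext i
        have := congrFun this i
        simp only [Pi.smul_apply, Algebra.smul_def, Pi.zero_apply, mul_eq_zero] at this
        rcases this with h | h
        · exact absurd ((map_eq_zero_iff _ (IsFractionRing.injective K[X] L)).mp h) hb0
        · exact h
      · ext1 i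
        apply IsFractionRing.injective K[X] L
        rw [RingHom.map_mulVec]
        change PL.mulVec (fun i => algebraMap K[X] L (v i)) i = _
        rw [hvw, Matrix.mulVec_smul]
        have : PL.mulVec w = 0 := hw
        simp [this]
  obtain ⟨v, hv, hPv⟩ := key
  have hex : ∃ r, (fun j => (v j).coeff r) ≠ 0 := by
    by_contra! hcon
    apply hv
    ext j r
    simpa using congrFun (hcon r) j
  classical
  have hco : ∀ i r, (A.mulVec (fun j => (v j).coeff (r + 1))) i +
      (B.mulVec (fun j => (v j).coeff r)) i = 0 := by
    intro i r
    have := congrArg (fun p : K[X] => p.coeff (r + 1)) (congrFun hPv i)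
    simpa [P, Matrix.mulVec, dotProduct, add_mul, Finset.sum_add_distrib, mul_assoc,
      Polynomial.finsetSum_coeff, smul_eq_mul] using this
  have hco0 : ∀ i, (A.mulVec (fun j => (v j).coeff 0)) i = 0 := by
    intro i
    have := congrArg (fun p : K[X] => p.coeff 0) (congrFun hPv i)
    simpa [P, Matrix.mulVec, dotProduct, add_mul, Finset.sum_add_distrib, mul_assoc,
      Polynomial.finsetSum_coeff, smul_eq_mul] using this
  refine ⟨fun i j => (v j).coeff (i + Nat.find hex), ?_, ?_, ?_⟩
  · simpa using Nat.find_spec hex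
  · rcases hz : Nat.find hex with _ | r
    · ext i; simpa using hco0 i
    · have hr : (fun j => (v j).coeff r) = 0 := by
        have := Nat.find_min hex (m := r) (by omega)
        simpa using this
      ext i
      have := hco i r
      rw [hr] at this
      simpa using this
  · intro i
    ext k
    have := hco k (i + Nat.find hex)
    rw [Pi.neg_apply, eq_neg_iff_add_eq_zero]
    rw [add_right_comm] at this
    exact this

theorem LinearMap.exists_pencil_chain {K V U : Type*} [Field K] [Infinite K]
    [AddCommGroup V] [Module K V] [AddCommGroup U] [Module K U] [FiniteDimensional K V]
    (A B : V →ₗ[K] U) (h : ∀ a : K, ∃ v : V, v ≠ 0 ∧ A v + a • B v = 0) :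
    ∃ F : ℕ → V, F 0 ≠ 0 ∧ A (F 0) = 0 ∧ ∀ i, A (F (i + 1)) = - B (F i) := by
  classical
  let U' : Submodule K U := LinearMap.range A ⊔ LinearMap.range B
  let A' : V →ₗ[K] U' := A.codRestrict U' fun v => Submodule.mem_sup_left ⟨v, rfl⟩
  let B' : V →ₗ[K] U' := B.codRestrict U' fun v => Submodule.mem_sup_right ⟨v, rfl⟩
  let bV := Module.finBasis K V
  let bU := Module.finBasis K U'
  have hmat : ∀ (T : V →ₗ[K] U') (x : Fin (Module.finrank K V) → K),
      (LinearMap.toMatrix bV bU T).mulVec x = bU.equivFun (T (bV.equivFun.symm x)) := by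
    intro T x
    have := LinearMap.toMatrix_mulVec_repr bV bU T (bV.equivFun.symm x)
    rw [← Module.Basis.equivFun_apply, ← Module.Basis.equivFun_apply,
      LinearEquiv.apply_symm_apply] at this
    exact this
  obtain ⟨F, hF0, hAF, hF⟩ := Matrix.exists_pencil_chain (LinearMap.toMatrix bV bU A')
    (LinearMap.toMatrix bV bU B') (by
      intro a
      obtain ⟨v, hv, hv0⟩ := h a
      refine ⟨bV.equivFun v, by simpa using hv, ?_⟩
      rw [Matrix.add_mulVec, Matrix.smul_mulVec, hmat, hmat, ← map_smul, ← map_add,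
        LinearEquiv.symm_apply_apply]
      have : A' v + a • B' v = 0 := Subtype.ext hv0
      rw [this, map_zero])
  refine ⟨fun i => bV.equivFun.symm (F i), by simpa only [ne_eq, LinearEquiv.map_eq_zero_iff] using hF0, ?_, fun i => ?_⟩
  · rw [hmat, LinearEquiv.map_eq_zero_iff] at hAF
    exact congrArg Subtype.val hAF
  · have := hF i
    rw [hmat, hmat, ← map_neg] at this
    exact congrArg Subtype.val (bU.equivFun.injective this)

section Apolarity

variable {σ : Type*}

/-- The action of a polynomial on linear functionals by `F ↦ F (s * ·)`. -/
noncomputable def polyAct (s : MvPolynomial σ ℂ) :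
    Module.Dual ℂ (MvPolynomial σ ℂ) →ₗ[ℂ] Module.Dual ℂ (MvPolynomial σ ℂ) :=
  (LinearMap.mulLeft ℂ s).dualMap

@[simp] theorem polyAct_apply (s : MvPolynomial σ ℂ) (F : Module.Dual ℂ (MvPolynomial σ ℂ))
    (g : MvPolynomial σ ℂ) : polyAct s F g = F (s * g) := rfl

theorem polyAct_mul (s t : MvPolynomial σ ℂ) (F : Module.Dual ℂ (MvPolynomial σ ℂ)) :
    polyAct (s * t) F = polyAct s (polyAct t F) := by
  refine LinearMap.ext fun g => ?_; simp only [polyAct_apply]; ring_nf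

theorem polyAct_comm (s t : MvPolynomial σ ℂ) (F : Module.Dual ℂ (MvPolynomial σ ℂ)) :
    polyAct s (polyAct t F) = polyAct t (polyAct s F) := by
  rw [← polyAct_mul, mul_comm, polyAct_mul]

theorem polyAct_add_smul (s t : MvPolynomial σ ℂ) (a : ℂ)
    (F : Module.Dual ℂ (MvPolynomial σ ℂ)) :
    polyAct (s + a • t) F = polyAct s F + a • polyAct t F := by
  refine LinearMap.ext fun g => ?_; simp [add_mul]

@[simp] theorem polyAct_one (F : Module.Dual ℂ (MvPolynomial σ ℂ)) : polyAct 1 F = F := by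
  refine LinearMap.ext fun g => ?_; simp

variable (σ) in
/-- The linear functionals on the polynomial ring concentrated in degree `k`. -/
noncomputable def gradedDual (k : ℕ) : Submodule ℂ (Module.Dual ℂ (MvPolynomial σ ℂ)) where
  carrier := {F | ∀ j ≠ k, ∀ g : MvPolynomial σ ℂ, g.IsHomogeneous j → F g = 0}
  add_mem' := fun hF hG j hj g hg => by simp [hF j hj g hg, hG j hj g hg]
  zero_mem' := fun j hj g hg => rfl
  smul_mem' := fun c F hF j hj g hg => by simp [hF j hj g hg]

theorem polyAct_mem_gradedDual {j k l : ℕ} (hl : j + k = l) {s : MvPolynomial σ ℂ}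
    (hs : s.IsHomogeneous j) {F : Module.Dual ℂ (MvPolynomial σ ℂ)} (hF : F ∈ gradedDual σ l) :
    polyAct s F ∈ gradedDual σ k := by
  intro i hi g hg
  exact hF (j + i) (by omega) _ (hs.mul hg)

theorem eq_zero_of_mem_gradedDual {k : ℕ} {F : Module.Dual ℂ (MvPolynomial σ ℂ)}
    (hF : F ∈ gradedDual σ k) (h : ∀ g : MvPolynomial σ ℂ, g.IsHomogeneous k → F g = 0) :
    F = 0 := by
  refine LinearMap.ext fun g => ?_
  rw [← sum_homogeneousComponent g, map_sum]
  refine Finset.sum_eq_zero fun i _ => ?_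
  by_cases hi : i = k
  · exact h _ (hi ▸ homogeneousComponent_isHomogeneous i g)
  · exact hF i hi _ (homogeneousComponent_isHomogeneous i g)

theorem eq_zero_of_polyAct_X_eq_zero {k : ℕ} {F : Module.Dual ℂ (MvPolynomial σ ℂ)}
    (hF : F ∈ gradedDual σ (k + 1)) (h : ∀ i, polyAct (X i) F = 0) : F = 0 := by
  have hm : ∀ (m : σ →₀ ℕ) (c : ℂ), F (monomial m c) = 0 := by
    intro m c
    by_cases hm : m = 0
    · subst hm
      exact hF 0 (by omega) _ (isHomogeneous_C σ c)
    · obtain ⟨i, hi⟩ : ∃ i, m i ≠ 0 := by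
        by_contra! hcon
        exact hm (Finsupp.ext hcon)
      have h1 := congrArg (fun G => G (monomial (m - Finsupp.single i 1) c)) (h i)
      simp only [polyAct_apply, LinearMap.zero_apply] at h1
      rw [X, monomial_mul, one_mul, add_tsub_cancel_of_le] at h1
      · exact h1
      · simpa [Nat.one_le_iff_ne_zero] using hi
  refine LinearMap.ext fun g => ?_
  induction g using MvPolynomial.induction_on' with
  | monomial m c => exact hm m c
  | add p q hp hq => simp only [map_add, hp, hq]

/-- Powers of linear forms span the forms of a given degree. -/
theorem eq_zero_of_forall_apply_pow_eq_zero (k : ℕ) :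
    ∀ {F : Module.Dual ℂ (MvPolynomial σ ℂ)}, F ∈ gradedDual σ k →
      (∀ t : MvPolynomial σ ℂ, t.IsHomogeneous 1 → F (t ^ k) = 0) → F = 0 := by
  induction k with
  | zero =>
    intro F hF h
    refine eq_zero_of_mem_gradedDual hF fun g hg => ?_
    rw [← totalDegree_zero_iff_isHomogeneous, totalDegree_eq_zero_iff_eq_C] at hg
    have h1 := h 0 (isHomogeneous_zero _ _ _)
    rw [hg, ← mul_one (C _), ← smul_eq_C_mul, map_smul]
    simpa using Or.inr h1
  | succ k ih =>
    intro F hF h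
    refine eq_zero_of_polyAct_X_eq_zero hF fun i => ?_
    refine ih (polyAct_mem_gradedDual (add_comm 1 k) (isHomogeneous_X ℂ i) hF) fun t ht => ?_
    let p : Polynomial ℂ := ∑ j ∈ Finset.range (k + 2),
      Polynomial.monomial j (F ((X i) ^ j * t ^ (k + 1 - j) * ((k + 1).choose j : MvPolynomial σ ℂ)))
    have hp : p = 0 := by
      refine Polynomial.funext fun a => ?_
      have h1 := h (a • X i + t) (by
        refine IsHomogeneous.add ?_ ht
        rw [smul_eq_C_mul]
        exact (isHomogeneous_X ℂ i).C_mul a)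
      rw [add_pow, map_sum] at h1
      simp only [p, Polynomial.eval_finsetSum, Polynomial.eval_monomial, Polynomial.eval_zero]
      rw [← h1]
      refine Finset.sum_congr rfl fun j _ => ?_
      rw [smul_pow, smul_mul_assoc, smul_mul_assoc, map_smul, smul_eq_mul, mul_comm]
    have h2 : p.coeff 1 = 0 := by rw [hp]; simp
    simp only [p, Polynomial.finsetSum_coeff, Polynomial.coeff_monomial] at h2
    rw [Finset.sum_ite_eq' (Finset.range (k + 2)) 1, if_pos (by simp), Nat.choose_one_right,
      ← nsmul_eq_mul', map_nsmul, nsmul_eq_mul, pow_one, Nat.add_sub_cancel] at h2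
    exact (mul_eq_zero.mp h2).resolve_left (Nat.cast_ne_zero.mpr (Nat.succ_ne_zero k))

end Apolarity

section Apolarity

variable {σ : Type*}

/-- Along a chain `s F (i + 1) = - t F i` starting in the kernel of `s`, the first linear
dependence forces a power of `t` to annihilate the initial term. -/
theorem exists_polyAct_pow_eq_zero {s t : MvPolynomial σ ℂ}
    {F : ℕ → Module.Dual ℂ (MvPolynomial σ ℂ)} (h0 : polyAct s (F 0) = 0)
    (hF : ∀ i, polyAct s (F (i + 1)) = - polyAct t (F i))
    {W : Submodule ℂ (Module.Dual ℂ (MvPolynomial σ ℂ))} [FiniteDimensional ℂ W]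
    (hW : ∀ i, F i ∈ W) :
    polyAct (t ^ Module.finrank ℂ W) (F 0) = 0 := by
  have hpow : ∀ j, polyAct (s ^ j) (F j) = (-1 : ℂ) ^ j • polyAct (t ^ j) (F 0) := by
    intro j
    induction j with
    | zero => simp
    | succ j ih =>
      rw [pow_succ s, polyAct_mul, hF, map_neg, polyAct_comm, ih, map_smul, ← polyAct_mul,
        ← pow_succ', pow_succ (-1 : ℂ), mul_neg_one, neg_smul]
  have hkill : ∀ i j, i < j → polyAct (s ^ j) (F i) = 0 := by
    intro i j hij
    obtain ⟨l, rfl⟩ := Nat.exists_eq_add_of_lt hij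
    rw [show i + l + 1 = l + 1 + i by ring, pow_add, polyAct_mul, hpow, map_smul, polyAct_comm,
      pow_succ, polyAct_mul, h0, map_zero, map_zero, smul_zero]
  by_cases hdep : ∃ j ≤ Module.finrank ℂ W, F j ∈ Submodule.span ℂ (F '' Set.Iio j)
  · obtain ⟨j, hj, hmem⟩ := hdep
    have hle : Submodule.span ℂ (F '' Set.Iio j) ≤ LinearMap.ker (polyAct (s ^ j)) := by
      rw [Submodule.span_le]
      rintro _ ⟨i, hi, rfl⟩
      exact hkill i j hi
    have h1 : polyAct (s ^ j) (F j) = 0 := hle hmem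
    rw [hpow, smul_eq_zero] at h1
    have h2 := h1.resolve_left (pow_ne_zero _ (by norm_num))
    obtain ⟨l, hl⟩ := Nat.exists_eq_add_of_le' hj
    rw [hl, pow_add, polyAct_mul, h2, map_zero]
  · push Not at hdep
    exfalso
    have hrank : ∀ j ≤ Module.finrank ℂ W + 1,
        j ≤ Module.finrank ℂ (Submodule.span ℂ (F '' Set.Iio j)) := by
      intro j
      induction j with
      | zero => simp
      | succ j ih =>
        intro hj
        have h1 := ih (by omega)
        have hfin : FiniteDimensional ℂ (Submodule.span ℂ (F '' Set.Iio (j + 1))) :=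
          FiniteDimensional.span_of_finite ℂ ((Set.finite_Iio _).image _)
        have hlt : Submodule.span ℂ (F '' Set.Iio j) < Submodule.span ℂ (F '' Set.Iio (j + 1)) := by
          refine lt_of_le_of_ne (Submodule.span_mono (Set.image_mono
            (Set.Iio_subset_Iio (Nat.le_succ j)))) fun heq => ?_
          refine hdep j (by omega) (heq ▸ Submodule.subset_span ⟨j, ?_, rfl⟩)
          simp
        have := Submodule.finrank_lt_finrank_of_lt hlt
        omega
    have h1 := hrank _ le_rfl
    have h2 : Submodule.span ℂ (F '' Set.Iio (Module.finrank ℂ W + 1)) ≤ W := by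
      rw [Submodule.span_le]
      rintro _ ⟨i, _, rfl⟩
      exact hW i
    have := Submodule.finrank_mono h2
    omega

/-- An easy case of Green's hyperplane restriction theorem: a space of functionals of degree `k`
and dimension at most `k` is mapped injectively by some linear form. -/
theorem exists_linear_polyAct_injective {k : ℕ} (n : ℕ) (hn : n ≤ k) :
    ∀ (W : Submodule ℂ (Module.Dual ℂ (MvPolynomial σ ℂ))), FiniteDimensional ℂ W →
      W ≤ gradedDual σ k → Module.finrank ℂ W = n →
      ∃ s : MvPolynomial σ ℂ, s.IsHomogeneous 1 ∧ ∀ F ∈ W, polyAct s F = 0 → F = 0 := by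
  induction n with
  | zero =>
    intro W _ _ h
    rw [Submodule.finrank_eq_zero] at h
    subst h
    exact ⟨0, isHomogeneous_zero _ _ _, fun F hF _ => by simpa using hF⟩
  | succ n ih =>
    intro W hfin hWk hW
    by_contra! hbad
    obtain ⟨θ, hθ⟩ : ∃ θ : Module.Dual ℂ W, θ ≠ 0 := by
      have : Nontrivial W := Module.nontrivial_of_finrank_pos (R := ℂ) (by omega)
      exact exists_ne 0
    let H : Submodule ℂ (Module.Dual ℂ (MvPolynomial σ ℂ)) := (LinearMap.ker θ).map W.subtype
    have hHW : H ≤ W := Submodule.map_subtype_le _ _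
    have hHrank : Module.finrank ℂ H = n := by
      have h1 : Module.finrank ℂ H = Module.finrank ℂ (LinearMap.ker θ) :=
        Submodule.finrank_map_subtype_eq _ _
      have h2 := LinearMap.finrank_range_add_finrank_ker θ
      rw [LinearMap.range_eq_top.mpr (LinearMap.surjective hθ), finrank_top,
        Module.finrank_self] at h2
      omega
    obtain ⟨s, hs, hsH⟩ := ih (by omega) H (Submodule.finiteDimensional_of_le hHW)
      (hHW.trans hWk) hHrank
    obtain ⟨F₀, hF₀W, hF₀s, hF₀⟩ := hbad s hs
    have hline : ∀ F ∈ W, polyAct s F = 0 → ∃ c : ℂ, F = c • F₀ := by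
      intro F hF hFs
      have hθ₀ : θ ⟨F₀, hF₀W⟩ ≠ 0 := fun h0 => hF₀ (hsH F₀ ⟨⟨F₀, hF₀W⟩, h0, rfl⟩ hF₀s)
      let c := θ ⟨F, hF⟩ / θ ⟨F₀, hF₀W⟩
      refine ⟨c, sub_eq_zero.mp (hsH _ ⟨⟨F, hF⟩ - c • ⟨F₀, hF₀W⟩, ?_, rfl⟩ ?_)⟩
      · rw [SetLike.mem_coe, LinearMap.mem_ker, map_sub, map_smul, smul_eq_mul, div_mul_cancel₀ _ hθ₀, sub_self]
      · rw [map_sub, map_smul, hFs, hF₀s]; simp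
    refine hF₀ (eq_zero_of_forall_apply_pow_eq_zero k (hWk hF₀W) fun t ht => ?_)
    obtain ⟨F, hF0, hAF, hF⟩ := LinearMap.exists_pencil_chain
      ((polyAct s).domRestrict W) ((polyAct t).domRestrict W) (by
        intro a
        obtain ⟨G, hGW, hG, hG0⟩ := hbad (s + a • t) (hs.add (by
          rw [smul_eq_C_mul]; exact ht.C_mul a))
        refine ⟨⟨G, hGW⟩, by simpa using hG0, ?_⟩
        rw [polyAct_add_smul] at hG
        exact hG)
    have hp := exists_polyAct_pow_eq_zero (s := s) (t := t) (F := fun i => (F i : Module.Dual ℂ _))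
      hAF hF (W := W) fun i => (F i).2
    obtain ⟨c, hc⟩ := hline _ (F 0).2 hAF
    have hc0 : c ≠ 0 := by
      rintro rfl
      exact hF0 (Subtype.ext (by simpa using hc))
    rw [hc, map_smul, smul_eq_zero, hW] at hp
    have h3 := congrArg (fun G => G (t ^ (k - (n + 1)))) (hp.resolve_left hc0)
    simp only [polyAct_apply, LinearMap.zero_apply] at h3
    rwa [← pow_add, Nat.add_sub_cancel' hn] at h3

/-- If linear forms act on `F` through a single linear form `s`, then `F` is a multiple of the
evaluation at a point. -/
theorem polyAct_eq_eval_smul {k : ℕ} {s : MvPolynomial σ ℂ} {p : σ → ℂ}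
    {F : Module.Dual ℂ (MvPolynomial σ ℂ)}
    (h : ∀ i, polyAct (X i) F = p i • polyAct s F) {g : MvPolynomial σ ℂ}
    (hg : g.IsHomogeneous k) : polyAct g F = eval p g • polyAct (s ^ k) F := by
  have hm : ∀ m : σ →₀ ℕ, ∀ G : Module.Dual ℂ (MvPolynomial σ ℂ),
      (∀ i, polyAct (X i) G = p i • polyAct s G) →
      polyAct (monomial m 1) G = eval p (monomial m 1) • polyAct (s ^ m.degree) G := by
    intro m
    induction m using Finsupp.induction_linear with
    | zero => intro G _; simp
    | add m₁ m₂ h₁ h₂ =>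
      intro G hG
      have hG' : ∀ i, polyAct (X i) (polyAct (s ^ m₂.degree) G) =
          p i • polyAct s (polyAct (s ^ m₂.degree) G) := by
        intro i
        rw [polyAct_comm, hG, map_smul, polyAct_comm]
      rw [show (monomial (m₁ + m₂) 1 : MvPolynomial σ ℂ) = monomial m₁ 1 * monomial m₂ 1 by
        rw [monomial_mul, one_mul], polyAct_mul, h₂ G hG, map_smul, h₁ _ hG', map_mul, map_add,
        pow_add, polyAct_mul, smul_smul, mul_comm]
    | single i n =>
      intro G hG
      rw [← X_pow_eq_monomial, Finsupp.degree_single]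
      induction n with
      | zero => simp
      | succ n ih =>
        rw [pow_succ, polyAct_mul, hG, map_smul, polyAct_comm, ih, map_smul, map_mul, pow_succ s,
          mul_comm _ s, polyAct_mul, smul_smul, eval_X, mul_comm]
  refine LinearMap.ext fun x => ?_
  have hsum := g.support_sum_monomial_coeff
  have h1 : polyAct g F x = ∑ m ∈ g.support, g.coeff m * polyAct (monomial m 1) F x := by
    conv_lhs => rw [polyAct_apply, ← hsum, Finset.sum_mul, map_sum]
    refine Finset.sum_congr rfl fun m _ => ?_
    rw [polyAct_apply, ← smul_eq_mul (g.coeff m), ← map_smul, ← smul_mul_assoc, smul_monomial,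
      smul_eq_mul, mul_one]
  have h2 : eval p g = ∑ m ∈ g.support, g.coeff m * eval p (monomial m 1) := by
    conv_lhs => rw [← hsum, map_sum]
    refine Finset.sum_congr rfl fun m _ => ?_
    simp [eval_monomial]
  rw [h1, h2, LinearMap.smul_apply, smul_eq_mul, Finset.sum_mul]
  refine Finset.sum_congr rfl fun m hms => ?_
  have hd : m.degree = k := by
    by_contra hne
    exact (mem_support_iff.mp hms) (hg.coeff_eq_zero hne)
  rw [hm m F h, hd, LinearMap.smul_apply, smul_eq_mul, mul_assoc]

/-- If `W'` in degree `k + 1` has all first derivatives in `W`, and `finrank W ≤ k` as well as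
`finrank W ≤ finrank W'`, then `W'` contains a nonzero multiple of an evaluation. -/
theorem exists_point_of_finrank_le {k : ℕ}
    {W W' : Submodule ℂ (Module.Dual ℂ (MvPolynomial σ ℂ))} [FiniteDimensional ℂ W]
    (hW : W ≤ gradedDual σ k) (hW' : W' ≤ gradedDual σ (k + 1))
    (hder : ∀ t : MvPolynomial σ ℂ, t.IsHomogeneous 1 → ∀ F ∈ W', polyAct t F ∈ W)
    (hk : Module.finrank ℂ W ≤ k) (hle : Module.finrank ℂ W ≤ Module.finrank ℂ W')
    (hne : W' ≠ ⊥) :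
    ∃ p : σ → ℂ, p ≠ 0 ∧ ∃ F ∈ W', ∃ c : ℂ, c ≠ 0 ∧
      ∀ g : MvPolynomial σ ℂ, g.IsHomogeneous (k + 1) → F g = c * eval p g := by
  obtain ⟨s, hs, hsW⟩ := exists_linear_polyAct_injective _ hk W inferInstance hW rfl
  let T : W' →ₗ[ℂ] W := (polyAct s).restrict (hder s hs)
  have hT : Function.Injective T := by
    rw [← LinearMap.ker_eq_bot, LinearMap.ker_eq_bot']
    intro F hF
    refine Subtype.ext (eq_zero_of_polyAct_X_eq_zero (hW' F.2) fun i => ?_)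
    refine hsW _ (hder _ (isHomogeneous_X ℂ i) _ F.2) ?_
    have : polyAct s F = 0 := congrArg Subtype.val hF
    rw [polyAct_comm, this, map_zero]
  have hfin : FiniteDimensional ℂ W' := FiniteDimensional.of_injective T hT
  have heq : Module.finrank ℂ W' = Module.finrank ℂ W :=
    le_antisymm (LinearMap.finrank_le_finrank_of_injective hT) hle
  let e : W' ≃ₗ[ℂ] W := LinearEquiv.ofInjectiveOfFinrankEq T hT heq
  have he : ∀ F : W', (e F : Module.Dual ℂ _) = polyAct s F := fun F => rfl
  let D (i : σ) : W' →ₗ[ℂ] W := (polyAct (X i)).restrict (hder _ (isHomogeneous_X ℂ i))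
  let M (i : σ) : Module.End ℂ W' := e.symm.toLinearMap ∘ₗ D i
  have hM : ∀ i F, polyAct s (M i F) = polyAct (X i) F := by
    intro i F
    rw [← he]
    simp [M, D]
  have hcomm : ∀ i j, Commute (M i) (M j) := by
    intro i j
    refine LinearMap.ext fun F => e.injective (Subtype.ext (sub_eq_zero.mp ?_))
    refine hsW _ (W.sub_mem (e _).2 (e _).2) ?_
    rw [map_sub, he, he, Module.End.mul_apply, Module.End.mul_apply, hM, hM,
      polyAct_comm s, polyAct_comm s, hM, hM, polyAct_comm, sub_self]
  have : Nontrivial W' := Submodule.nontrivial_iff_ne_bot.mpr hne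
  obtain ⟨F, hF, hFM⟩ := exists_common_eigenvector _ M hcomm rfl
  choose p hp using hFM
  have hX : ∀ i, polyAct (X i) (F : Module.Dual ℂ (MvPolynomial σ ℂ)) = p i • polyAct s F := by
    intro i
    rw [← hM, hp, Submodule.coe_smul, map_smul]
  have hval : ∀ g : MvPolynomial σ ℂ, g.IsHomogeneous (k + 1) →
      (F : Module.Dual ℂ (MvPolynomial σ ℂ)) g = F.1 (s ^ (k + 1)) * eval p g := by
    intro g hg
    have h1 := congrArg (fun G => G 1) (polyAct_eq_eval_smul hX hg)
    simpa [mul_comm] using h1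
  have hFne : (F : Module.Dual ℂ (MvPolynomial σ ℂ)) ≠ 0 := by simpa using hF
  refine ⟨p, ?_, F, F.2, F.1 (s ^ (k + 1)), ?_, hval⟩
  · rintro rfl
    exact hFne (eq_zero_of_polyAct_X_eq_zero (hW' F.2) fun i => by rw [hX]; simp)
  · intro h0
    exact hFne (eq_zero_of_mem_gradedDual (hW' F.2) fun g hg => by rw [hval g hg, h0, zero_mul])

end Apolarity

theorem LinearMap.finrank_range_eq_of_ker_eq {K V U U' : Type*} [Field K] [AddCommGroup V]
    [Module K V] [FiniteDimensional K V] [AddCommGroup U] [Module K U] [AddCommGroup U']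
    [Module K U'] {A : V →ₗ[K] U} {B : V →ₗ[K] U'} (h : LinearMap.ker A = LinearMap.ker B) :
    Module.finrank K (LinearMap.range A) = Module.finrank K (LinearMap.range B) := by
  have h1 := LinearMap.finrank_range_add_finrank_ker A
  have h2 := LinearMap.finrank_range_add_finrank_ker B
  rw [h] at h1
  omega

theorem finiteDimensional_homogeneousSubmodule (σ : Type*) [Finite σ] (k : ℕ) :
    FiniteDimensional ℂ (homogeneousSubmodule σ ℂ k) :=
  Module.Finite.iff_fg.mpr (homogeneousSubmodule_fg σ ℂ k)

section Apolarity

variable {σ : Type*}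

/-- The derivatives of degree `k` of a functional `φ` of degree `n`. -/
noncomputable def inverseSystem (φ : Module.Dual ℂ (MvPolynomial σ ℂ)) (n k : ℕ) :
    Submodule ℂ (Module.Dual ℂ (MvPolynomial σ ℂ)) :=
  LinearMap.range
    (((LinearMap.mul ℂ (MvPolynomial σ ℂ)).compr₂ φ).domRestrict (homogeneousSubmodule σ ℂ (n - k)))

theorem mem_inverseSystem {φ F : Module.Dual ℂ (MvPolynomial σ ℂ)} {n k : ℕ} :
    F ∈ inverseSystem φ n k ↔
      ∃ g : MvPolynomial σ ℂ, g.IsHomogeneous (n - k) ∧ polyAct g φ = F := by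
  constructor
  · rintro ⟨⟨g, hg⟩, rfl⟩
    exact ⟨g, hg, rfl⟩
  · rintro ⟨g, hg, rfl⟩
    exact ⟨⟨g, hg⟩, rfl⟩

theorem inverseSystem_le_gradedDual {φ : Module.Dual ℂ (MvPolynomial σ ℂ)} {n k : ℕ}
    (hφ : φ ∈ gradedDual σ n) (hk : k ≤ n) : inverseSystem φ n k ≤ gradedDual σ k := by
  intro F hF
  obtain ⟨g, hg, rfl⟩ := mem_inverseSystem.mp hF
  exact polyAct_mem_gradedDual (by omega) hg hφ

theorem polyAct_mem_inverseSystem {φ : Module.Dual ℂ (MvPolynomial σ ℂ)} {n k : ℕ} (hk : k < n)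
    {t : MvPolynomial σ ℂ} (ht : t.IsHomogeneous 1) {F : Module.Dual ℂ (MvPolynomial σ ℂ)}
    (hF : F ∈ inverseSystem φ n (k + 1)) : polyAct t F ∈ inverseSystem φ n k := by
  obtain ⟨g, hg, rfl⟩ := mem_inverseSystem.mp hF
  refine mem_inverseSystem.mpr ⟨t * g, ?_, polyAct_mul _ _ _⟩
  have := ht.mul hg
  rwa [show 1 + (n - (k + 1)) = n - k by omega] at this

/-- The Hilbert function of a graded Artinian Gorenstein algebra is symmetric. -/
theorem finrank_inverseSystem_symm [Finite σ] {φ : Module.Dual ℂ (MvPolynomial σ ℂ)} {n k : ℕ}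
    (hφ : φ ∈ gradedDual σ n) (hk : k ≤ n) :
    Module.finrank ℂ (inverseSystem φ n k) = Module.finrank ℂ (inverseSystem φ n (n - k)) := by
  have := finiteDimensional_homogeneousSubmodule σ
  let B (a b : ℕ) : homogeneousSubmodule σ ℂ a →ₗ[ℂ] homogeneousSubmodule σ ℂ b →ₗ[ℂ] ℂ :=
    ((LinearMap.mul ℂ (MvPolynomial σ ℂ)).compr₂ φ).domRestrict₁₂ _ _
  have hB : ∀ k ≤ n, Module.finrank ℂ (inverseSystem φ n k) =
      Module.finrank ℂ (LinearMap.range (B (n - k) k)) := by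
    intro k hk
    refine LinearMap.finrank_range_eq_of_ker_eq (le_antisymm ?_ ?_)
    · intro g hg
      ext h
      exact congrArg (fun G : Module.Dual ℂ (MvPolynomial σ ℂ) => G h) hg
    · intro g hg
      refine eq_zero_of_mem_gradedDual (inverseSystem_le_gradedDual hφ hk ⟨g, rfl⟩) fun h hh => ?_
      exact congrArg (fun G => G ⟨h, hh⟩) hg
  have hflip : (B (n - k) k).flip = B k (n - k) := by
    ext g h
    exact congrArg φ (mul_comm _ _)
  rw [hB k hk, hB (n - k) (Nat.sub_le _ _), ← finrank_range_flip, hflip, Nat.sub_sub_self hk]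

variable {ι : Type*} [Fintype ι] (P : ι → σ → ℂ)

/-- The functional of degree `k` given by a weighted sum of evaluations. -/
noncomputable def pointFunctional (k : ℕ) : (ι → ℂ) →ₗ[ℂ] Module.Dual ℂ (MvPolynomial σ ℂ) :=
  Fintype.linearCombination ℂ fun i =>
    (aeval (P i) : MvPolynomial σ ℂ →ₐ[ℂ] ℂ).toLinearMap ∘ₗ homogeneousComponent k

theorem pointFunctional_mem_gradedDual (k : ℕ) (c : ι → ℂ) :
    pointFunctional P k c ∈ gradedDual σ k := by
  intro j hj g hg
  simp [pointFunctional, Fintype.linearCombination_apply, homogeneousComponent_of_mem hg, hj.symm]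

theorem pointFunctional_apply {k : ℕ} (c : ι → ℂ) {g : MvPolynomial σ ℂ}
    (hg : g.IsHomogeneous k) : pointFunctional P k c g = ∑ i, c i * eval (P i) g := by
  simp [pointFunctional, Fintype.linearCombination_apply, homogeneousComponent_eq_self hg,
    aeval_eq_eval]

theorem polyAct_pointFunctional {j k l : ℕ} (hl : j + k = l) (c : ι → ℂ) {g : MvPolynomial σ ℂ}
    (hg : g.IsHomogeneous j) :
    polyAct g (pointFunctional P l c) = pointFunctional P k (fun i => c i * eval (P i) g) := by
  rw [← sub_eq_zero]
  refine eq_zero_of_mem_gradedDual (Submodule.sub_mem _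
    (polyAct_mem_gradedDual hl hg (pointFunctional_mem_gradedDual P l c))
    (pointFunctional_mem_gradedDual P k _)) fun h hh => ?_
  rw [LinearMap.sub_apply, polyAct_apply, pointFunctional_apply P c (hl ▸ hg.mul hh),
    pointFunctional_apply P _ hh, sub_eq_zero]
  exact Finset.sum_congr rfl fun i _ => by rw [map_mul]; ring

/-- The linear relations among the evaluations at the points `P i` on forms of degree `< k`. -/
noncomputable def pointRelations (k : ℕ) : Submodule ℂ (ι → ℂ) :=
  ⨅ j ∈ Set.Iio k, LinearMap.ker (pointFunctional P j)

variable {P}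

theorem mem_pointRelations {k : ℕ} {c : ι → ℂ} :
    c ∈ pointRelations P k ↔ ∀ j < k, ∀ g : MvPolynomial σ ℂ, g.IsHomogeneous j →
      ∑ i, c i * eval (P i) g = 0 := by
  simp only [pointRelations, Submodule.mem_iInf, Set.mem_Iio, LinearMap.mem_ker]
  refine forall₂_congr fun j _ => ⟨fun h g hg => ?_, fun h => ?_⟩
  · rw [← pointFunctional_apply P c hg, h]; rfl
  · exact eq_zero_of_mem_gradedDual (pointFunctional_mem_gradedDual P j c) fun g hg => by
      rw [pointFunctional_apply P c hg, h g hg]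

theorem mem_pointRelations_succ {k : ℕ} {c : ι → ℂ} :
    c ∈ pointRelations P (k + 1) ↔ c ∈ pointRelations P k ∧ pointFunctional P k c = 0 := by
  simp only [pointRelations, Submodule.mem_iInf, Set.mem_Iio, LinearMap.mem_ker]
  constructor
  · exact fun h => ⟨fun j hj => h j (by omega), h k (by omega)⟩
  · rintro ⟨h, hk⟩ j hj
    rcases Nat.lt_succ_iff_lt_or_eq.mp hj with hj | rfl
    exacts [h j hj, hk]

theorem pointRelations_zero : pointRelations P 0 = ⊤ := by
  simp [pointRelations]

theorem mul_mem_pointRelations {j k l : ℕ} (hl : j + k ≤ l) {c : ι → ℂ}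
    (hc : c ∈ pointRelations P l) {g : MvPolynomial σ ℂ} (hg : g.IsHomogeneous j) :
    (fun i => c i * eval (P i) g) ∈ pointRelations P k := by
  rw [mem_pointRelations] at hc ⊢
  intro i hi h hh
  rw [← hc (j + i) (by omega) _ (hg.mul hh)]
  exact Finset.sum_congr rfl fun i _ => by rw [map_mul]; ring

theorem finrank_map_pointFunctional (k : ℕ) :
    Module.finrank ℂ ((pointRelations P k).map (pointFunctional P k)) +
      Module.finrank ℂ (pointRelations P (k + 1)) = Module.finrank ℂ (pointRelations P k) := by
  have h : pointRelations P (k + 1) = (LinearMap.ker ((pointFunctional P k).domRestrict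
      (pointRelations P k))).map (pointRelations P k).subtype := by
    ext c
    simp [mem_pointRelations_succ, and_comm]
  rw [h, Submodule.finrank_map_subtype_eq, ← LinearMap.range_domRestrict,
    LinearMap.finrank_range_add_finrank_ker]

theorem pointRelations_succ_eq_ker {l : MvPolynomial σ ℂ} (hl : l.IsHomogeneous 1)
    (hP : ∀ i, eval (P i) l = 1) (k : ℕ) :
    pointRelations P (k + 1) = LinearMap.ker (pointFunctional P k) := by
  ext c
  rw [mem_pointRelations_succ, LinearMap.mem_ker]
  refine ⟨fun h => h.2, fun h => ⟨mem_pointRelations.mpr fun j hj g hg => ?_, h⟩⟩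
  have hg' : (l ^ (k - j) * g).IsHomogeneous k := by
    have := (hl.pow (k - j)).mul hg
    rwa [show 1 * (k - j) + j = k by omega] at this
  have h1 := pointFunctional_apply P c hg'
  rw [h, LinearMap.zero_apply] at h1
  rw [h1]
  exact Finset.sum_congr rfl fun i _ => by simp [hP]

end Apolarity

section Relations

variable {σ ι : Type*} [Fintype ι] {P : ι → σ → ℂ}

theorem exists_pointFunctional_ne_zero (hinj : Function.Injective P) {c : ι → ℂ} (hc : c ≠ 0) :
    ∃ k, pointFunctional P k c ≠ 0 := by
  classical
  by_contra! h
  have hzero : ∀ g : MvPolynomial σ ℂ, ∑ i, c i * eval (P i) g = 0 := by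
    intro g
    conv_lhs => rw [← sum_homogeneousComponent g]
    simp_rw [map_sum, Finset.mul_sum]
    rw [Finset.sum_comm]
    refine Finset.sum_eq_zero fun k _ => ?_
    rw [← pointFunctional_apply P c (homogeneousComponent_isHomogeneous k g), h]
    rfl
  obtain ⟨i, hi⟩ := Function.ne_iff.mp hc
  have hsep : ∀ j, ∃ g : MvPolynomial σ ℂ, eval (P j) g = 0 ∧ (j ≠ i → eval (P i) g ≠ 0) := by
    intro j
    by_cases hj : j = i
    · exact ⟨0, map_zero _, fun h => (h hj).elim⟩
    · obtain ⟨q, hq⟩ := Function.ne_iff.mp (hinj.ne hj)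
      exact ⟨X q - C (P j q), by simp, fun _ => by simpa [sub_eq_zero] using Ne.symm hq⟩
  choose g hg hg' using hsep
  have h1 := hzero (∏ j ∈ Finset.univ.erase i, g j)
  rw [Finset.sum_eq_single i _ (by simp)] at h1
  · simp only [map_prod, mul_eq_zero, Finset.prod_eq_zero_iff] at h1
    rcases h1 with h1 | ⟨j, hj, h1⟩
    · exact hi h1
    · exact hg' j (Finset.ne_of_mem_erase hj) h1
  · intro j _ hj
    rw [map_prod, Finset.prod_eq_zero (Finset.mem_erase.mpr ⟨hj, Finset.mem_univ _⟩) (hg j),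
      mul_zero]

theorem exists_mem_pointRelations_of_add (k m : ℕ) {c : ι → ℂ}
    (hc : c ∈ pointRelations P (k + m)) (h : pointFunctional P (k + m) c ≠ 0) :
    ∃ c' ∈ pointRelations P k, pointFunctional P k c' ≠ 0 := by
  induction m generalizing c with
  | zero => exact ⟨c, hc, h⟩
  | succ m ih =>
    obtain ⟨i, hi⟩ : ∃ i, polyAct (X i) (pointFunctional P (k + m + 1) c) ≠ 0 := by
      by_contra! hcon
      exact h (eq_zero_of_polyAct_X_eq_zero (pointFunctional_mem_gradedDual P _ c) hcon)
    rw [polyAct_pointFunctional P (Nat.add_comm 1 (k + m)) c (isHomogeneous_X ℂ i)] at hi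
    exact ih (mul_mem_pointRelations (Nat.add_comm 1 (k + m)).le hc (isHomogeneous_X ℂ i)) hi

theorem exists_mem_pointRelations (hinj : Function.Injective P) {k : ℕ}
    (h : pointRelations P k ≠ ⊥) : ∃ c ∈ pointRelations P k, pointFunctional P k c ≠ 0 := by
  classical
  obtain ⟨c, hc, hc0⟩ := Submodule.exists_mem_ne_zero_of_ne_bot h
  have hex := exists_pointFunctional_ne_zero hinj hc0
  have hmem : c ∈ pointRelations P (Nat.find hex) := by
    simp only [pointRelations, Submodule.mem_iInf, Set.mem_Iio, LinearMap.mem_ker]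
    exact fun j hj => not_not.mp (Nat.find_min hex hj)
  have hk : k ≤ Nat.find hex := by
    by_contra! hlt
    simp only [pointRelations, Submodule.mem_iInf, Set.mem_Iio, LinearMap.mem_ker] at hc
    exact Nat.find_spec hex (hc _ hlt)
  obtain ⟨m, hm⟩ := Nat.exists_eq_add_of_le hk
  have hne := Nat.find_spec hex
  rw [hm] at hmem hne
  exact exists_mem_pointRelations_of_add k m hmem hne

theorem inverseSystem_pointFunctional_le {n k : ℕ} (hk : k ≤ n) {c : ι → ℂ}
    (hc : c ∈ pointRelations P n) :
    inverseSystem (pointFunctional P n c) n k ≤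
      (pointRelations P k).map (pointFunctional P k) := by
  intro F hF
  obtain ⟨g, hg, rfl⟩ := mem_inverseSystem.mp hF
  rw [polyAct_pointFunctional P (Nat.sub_add_cancel hk) c hg]
  exact Submodule.mem_map_of_mem (mul_mem_pointRelations (Nat.sub_add_cancel hk).le hc hg)

theorem sum_range_min_add_one (e : ℕ) :
    ∑ k ∈ Finset.range (2 * e + 1), (min k (2 * e - k) + 1) = (e + 1) ^ 2 := by
  induction e with
  | zero => simp
  | succ e ih =>
    rw [show 2 * (e + 1) + 1 = (2 * e + 1 + 1) + 1 by ring, Finset.sum_range_succ,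
      Finset.sum_range_succ']
    have : ∀ k ∈ Finset.range (2 * e + 1), min (k + 1) (2 * (e + 1) - (k + 1)) + 1 =
        (min k (2 * e - k) + 1) + 1 := by
      intro k hk
      rw [Finset.mem_range] at hk
      omega
    rw [Finset.sum_congr rfl this, Finset.sum_add_distrib, ih]
    simp
    ring_nf
    omega

theorem le_finrank_inverseSystem [Finite σ] {e : ℕ} {l : MvPolynomial σ ℂ}
    (hl : l.IsHomogeneous 1) (hP : ∀ i, eval (P i) l = 1)
    (hbpf : ∀ p : σ → ℂ, p ≠ 0 → (∀ g : MvPolynomial σ ℂ, g.IsHomogeneous (e + 1) →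
      (∀ i, eval (P i) g = 0) → eval p g = 0) → eval p l ≠ 0)
    {c : ι → ℂ} (hc : c ∈ pointRelations P (2 * e)) (hne : pointFunctional P (2 * e) c ≠ 0)
    {k : ℕ} (hk : k ≤ 2 * e) :
    min k (2 * e - k) + 1 ≤
      Module.finrank ℂ (inverseSystem (pointFunctional P (2 * e) c) (2 * e) k) := by
  set φ := pointFunctional P (2 * e) c with hφdef
  have hφ : φ ∈ gradedDual σ (2 * e) := pointFunctional_mem_gradedDual P _ c
  have hfin : ∀ k, FiniteDimensional ℂ (inverseSystem φ (2 * e) k) := fun k => by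
    have := finiteDimensional_homogeneousSubmodule σ (2 * e - k)
    rw [inverseSystem]; infer_instance
  have upper : ∀ j ≤ e, j + 1 ≤ Module.finrank ℂ (inverseSystem φ (2 * e) (2 * e - j)) := by
    intro j hj
    induction j with
    | zero =>
      rw [Nat.succ_le_iff, Module.finrank_pos_iff_exists_ne_zero]
      refine ⟨⟨φ, mem_inverseSystem.mpr ⟨1, ?_, polyAct_one φ⟩⟩, ?_⟩
      · simpa using isHomogeneous_one σ ℂ
      · exact fun h => hne (congrArg Subtype.val h)
    | succ j ih =>
      have ih := ih (by omega)
      obtain ⟨k, hkj⟩ : ∃ k, 2 * e - j = k + 1 := ⟨2 * e - j - 1, by omega⟩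
      rw [show 2 * e - (j + 1) = k by omega]
      rw [hkj] at ih
      by_contra! hlt
      have hW' : inverseSystem φ (2 * e) (k + 1) ≠ ⊥ := by
        intro h
        rw [h, finrank_bot] at ih
        omega
      obtain ⟨p, hp, F, hF, a, ha, hFa⟩ := exists_point_of_finrank_le
        (inverseSystem_le_gradedDual hφ (by omega)) (inverseSystem_le_gradedDual hφ (by omega))
        (fun t ht F hF => polyAct_mem_inverseSystem (by omega) ht hF) (by omega) (by omega) hW'
      obtain ⟨b, hb, rfl⟩ := inverseSystem_pointFunctional_le (by omega) hc hF
      obtain ⟨q, hq⟩ := Function.ne_iff.mp hp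
      refine hbpf p hp (fun g hg hgP => ?_) ?_
      · have hdeg : (g * X q ^ (k - e)).IsHomogeneous (k + 1) := by
          have := hg.mul ((isHomogeneous_X ℂ q).pow (k - e))
          rwa [show e + 1 + 1 * (k - e) = k + 1 by omega] at this
        have h := hFa _ hdeg
        rw [pointFunctional_apply P b hdeg, Finset.sum_eq_zero fun i _ => by simp [hgP]] at h
        simpa [ha, show p q ≠ 0 from hq] using h.symm
      · have hX : (X q ^ k : MvPolynomial σ ℂ).IsHomogeneous k := by
          simpa using (isHomogeneous_X ℂ q).pow k
        have hdeg : (l * X q ^ k).IsHomogeneous (k + 1) := by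
          rw [add_comm]; exact hl.mul hX
        have h := hFa _ hdeg
        have h0 := mem_pointRelations.mp hb k (Nat.lt_succ_self k) _ hX
        rw [pointFunctional_apply P b hdeg] at h
        simp only [map_mul, hP, one_mul, h0] at h
        simpa [ha, show p q ≠ 0 from hq] using h.symm
  rcases le_total k e with hke | hke
  · rw [finrank_inverseSystem_symm hφ hk]
    have := upper k hke
    omega
  · have := upper (2 * e - k) (by omega)
    rw [Nat.sub_sub_self hk] at this
    omega

theorem finrank_pointRelations [Finite σ] {e : ℕ} (hcard : Fintype.card ι = (e + 1) ^ 2)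
    (hinj : Function.Injective P) {l : MvPolynomial σ ℂ}
    (hl : l.IsHomogeneous 1) (hP : ∀ i, eval (P i) l = 1)
    (hbpf : ∀ p : σ → ℂ, p ≠ 0 → (∀ g : MvPolynomial σ ℂ, g.IsHomogeneous (e + 1) →
      (∀ i, eval (P i) g = 0) → eval p g = 0) → eval p l ≠ 0)
    (hdef : pointRelations P (2 * e) ≠ ⊥) {k : ℕ} (hk : k ≤ 2 * e) :
    Module.finrank ℂ (pointRelations P k) =
      Module.finrank ℂ (pointRelations P (k + 1)) + (min k (2 * e - k) + 1) := by
  obtain ⟨c, hc, hne⟩ := exists_mem_pointRelations hinj hdef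
  let δ (k : ℕ) := Module.finrank ℂ ((pointRelations P k).map (pointFunctional P k))
  have hδ : ∀ k, δ k + Module.finrank ℂ (pointRelations P (k + 1)) =
      Module.finrank ℂ (pointRelations P k) := finrank_map_pointFunctional
  have hle : ∀ k ∈ Finset.range (2 * e + 1), min k (2 * e - k) + 1 ≤ δ k := by
    intro k hk
    rw [Finset.mem_range, Nat.lt_succ_iff] at hk
    exact (le_finrank_inverseSystem hl hP hbpf hc hne hk).trans
      (Submodule.finrank_mono (inverseSystem_pointFunctional_le hk hc))
  have htel : ∀ n, ∑ k ∈ Finset.range n, δ k + Module.finrank ℂ (pointRelations P n) =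
      Fintype.card ι := by
    intro n
    induction n with
    | zero => rw [pointRelations_zero, finrank_top]; simp
    | succ n ih => rw [Finset.sum_range_succ, add_assoc, hδ, ih]
  have hsum := Finset.sum_le_sum hle
  have heq := (Finset.sum_eq_sum_iff_of_le hle).mp
    (le_antisymm hsum (by rw [sum_range_min_add_one, ← hcard, ← htel (2 * e + 1)]; omega))
  have := heq k (Finset.mem_range.mpr (Nat.lt_succ_of_le hk))
  have := hδ k
  omega

end Relations

theorem MvPolynomial.derivation_aeval {R A σ : Type*} [CommRing R] [CommRing A] [Algebra R A]
    [Fintype σ] (D : Derivation R A A) (φ : σ → A) (f : MvPolynomial σ R) :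
    D (aeval φ f) = ∑ j, aeval φ (pderiv j f) * D (φ j) := by
  classical
  induction f using MvPolynomial.induction_on with
  | C a => simp [algHom_C]
  | add p q hp hq => simp [hp, hq, add_mul, Finset.sum_add_distrib]
  | mul_X p i hp =>
    simp only [map_mul, aeval_X, Derivation.leibniz, hp, smul_eq_mul, pderiv_X, map_add, add_mul,
      Finset.sum_add_distrib, Finset.mul_sum]
    congr 1
    · simp [Pi.single_apply, apply_ite]
    · exact Finset.sum_congr rfl fun j _ => by ring

theorem MvPolynomial.IsHomogeneous.eval_smul {R σ : Type*} [CommSemiring R] {f : MvPolynomial σ R}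
    {n : ℕ} (hf : f.IsHomogeneous n) (a : R) (x : σ → R) :
    eval (a • x) f = a ^ n * eval x f := by
  rw [eval_eq, eval_eq, Finset.mul_sum]
  refine Finset.sum_congr rfl fun m hm => ?_
  have h := hf.degree_eq_sum_deg_support hm
  simp only [Pi.smul_apply, smul_eq_mul, mul_pow, Finset.prod_mul_distrib, Finset.prod_pow_eq_pow_sum]
  rw [show ∑ i ∈ m.support, m i = n from h.symm ▸ rfl]
  ring

/-- The linear form attached to a functional on `ℂ ^ n`. -/
noncomputable def linearForm {n : ℕ} : Module.Dual ℂ (Fin n → ℂ) →ₗ[ℂ] MvPolynomial (Fin n) ℂ where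
  toFun l := ∑ j, C (l (Pi.single j 1)) * X j
  map_add' l l' := by simp [add_mul, Finset.sum_add_distrib]
  map_smul' a l := by simp [Finset.smul_sum, smul_eq_C_mul, mul_assoc]

theorem linearForm_isHomogeneous {n : ℕ} (l : Module.Dual ℂ (Fin n → ℂ)) :
    (linearForm l).IsHomogeneous 1 :=
  IsHomogeneous.sum _ _ _ fun j _ => isHomogeneous_C_mul_X _ j

@[simp] theorem eval_linearForm {n : ℕ} (l : Module.Dual ℂ (Fin n → ℂ)) (x : Fin n → ℂ) :
    eval x (linearForm l) = l x := by
  conv_rhs => rw [← LinearMap.sum_single_apply _ x, map_sum]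
  simp only [linearForm, LinearMap.coe_mk, AddHom.coe_mk, map_sum, map_mul, eval_C, eval_X]
  refine Finset.sum_congr rfl fun j _ => ?_
  rw [mul_comm, ← smul_eq_mul, ← map_smul, ← Pi.single_smul, smul_eq_mul, mul_one]

theorem Submodule.exists_coordinates_of_finrank_eq_add_two {K V : Type*} [Field K]
    [AddCommGroup V] [Module K V] [FiniteDimensional K V] (Y : Submodule K V)
    (h : Module.finrank K V = Module.finrank K Y + 2) :
    ∃ (l₁ l₂ : Module.Dual K V) (a₁ a₂ : V), l₁ a₁ = 1 ∧ l₁ a₂ = 0 ∧ l₂ a₁ = 0 ∧ l₂ a₂ = 1 ∧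
      (∀ y ∈ Y, l₁ y = 0 ∧ l₂ y = 0) ∧ ∀ x, x - l₁ x • a₁ - l₂ x • a₂ ∈ Y := by
  have hq : Module.finrank K (V ⧸ Y) = 2 := by
    have := Y.finrank_quotient_add_finrank
    omega
  let b := Module.finBasisOfFinrankEq K (V ⧸ Y) hq
  obtain ⟨a₁, ha₁⟩ := Y.mkQ_surjective (b 0)
  obtain ⟨a₂, ha₂⟩ := Y.mkQ_surjective (b 1)
  refine ⟨b.coord 0 ∘ₗ Y.mkQ, b.coord 1 ∘ₗ Y.mkQ, a₁, a₂, ?_, ?_, ?_, ?_, ?_, fun x => ?_⟩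
  · simp only [LinearMap.comp_apply, ha₁]; simp
  · simp only [LinearMap.comp_apply, ha₂]; simp
  · simp only [LinearMap.comp_apply, ha₁]; simp
  · simp only [LinearMap.comp_apply, ha₂]; simp
  · intro y hy
    have : Y.mkQ y = 0 := by simpa using hy
    simp only [LinearMap.comp_apply, this, map_zero, and_self]
  · rw [← Submodule.Quotient.mk_eq_zero, ← Submodule.mkQ_apply, map_sub, map_sub, map_smul,
      map_smul, ha₁, ha₂]
    have := b.sum_repr (Y.mkQ x)
    rw [Fin.sum_univ_two] at this
    rw [sub_sub, sub_eq_zero]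
    exact this.symm

section Line

variable {σ : Type*}

/-- The restriction of a polynomial to the line through `x` with direction `y`. -/
noncomputable def lineRestriction (x y : σ → ℂ) : MvPolynomial σ ℂ →ₐ[ℂ] Polynomial ℂ :=
  aeval fun j => .C (x j) + .C (y j) * .X

theorem eval_lineRestriction (x y : σ → ℂ) (f : MvPolynomial σ ℂ) (t : ℂ) :
    (lineRestriction x y f).eval t = eval (x + t • y) f := by
  rw [← Polynomial.coe_aeval_eq_eval, ← aeval_eq_eval, lineRestriction]
  change (Polynomial.aeval t).comp (aeval _) f = _
  rw [comp_aeval]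
  congr 2
  ext j
  simp only [map_add, map_mul, Polynomial.aeval_C, Polynomial.aeval_X, Pi.add_apply, Pi.smul_apply,
    smul_eq_mul, Algebra.algebraMap_self, RingHom.id_apply]
  ring

theorem derivative_lineRestriction [Fintype σ] (x y : σ → ℂ) (f : MvPolynomial σ ℂ) :
    (lineRestriction x y f).derivative =
      ∑ j, lineRestriction x y (pderiv j f) * Polynomial.C (y j) := by
  have h := derivation_aeval (Polynomial.derivative' (R := ℂ))
    (fun j => Polynomial.C (x j) + Polynomial.C (y j) * Polynomial.X) f
  refine h.trans (Finset.sum_congr rfl fun j _ => ?_)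
  rw [lineRestriction]
  congr 1
  change Polynomial.derivative (_ + _) = _
  simp only [Polynomial.derivative_add, Polynomial.derivative_C, zero_add,
    Polynomial.derivative_C_mul, Polynomial.derivative_X, mul_one]

theorem natDegree_lineRestriction_le (x y : σ → ℂ) {f : MvPolynomial σ ℂ} {d : ℕ}
    (hf : f.IsHomogeneous d) : (lineRestriction x y f).natDegree ≤ d := by
  have := aeval_natDegree_le (n := 1) f hf.totalDegree_le
    (fun j => Polynomial.C (x j) + Polynomial.C (y j) * Polynomial.X) fun j => by compute_degree
  simpa [lineRestriction] using this

theorem eval_add_smul_of_sum_pderiv_eq_zero [Fintype σ] {f : MvPolynomial σ ℂ} {v : σ → ℂ}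
    (h : ∑ j, v j • pderiv j f = 0) (x : σ → ℂ) (t : ℂ) :
    eval (x + t • v) f = eval x f := by
  have hder : (lineRestriction x v f).derivative = 0 := by
    have h0 := congrArg (lineRestriction x v) h
    rw [derivative_lineRestriction]
    simpa [Polynomial.smul_eq_C_mul, mul_comm] using h0
  have h0 := eval_lineRestriction x v f 0
  rw [zero_smul, add_zero] at h0
  rw [← eval_lineRestriction, ← h0,
    Polynomial.eq_C_of_natDegree_eq_zero (Polynomial.derivative_eq_zero.mp hder)]
  simp

end Line

/-- The evaluation of forms of degree `k` at the points `P i`. -/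
noncomputable def evalForms {σ ι : Type*} (P : ι → σ → ℂ) (k : ℕ) :
    homogeneousSubmodule σ ℂ k →ₗ[ℂ] ι → ℂ :=
  LinearMap.pi fun i => (aeval (P i)).toLinearMap.domRestrict _

@[simp] theorem evalForms_apply {σ ι : Type*} (P : ι → σ → ℂ) (k : ℕ)
    (f : homogeneousSubmodule σ ℂ k) (i : ι) :
    evalForms P k f i = eval (P i) (f : MvPolynomial σ ℂ) := by
  simp [evalForms, aeval_eq_eval]

theorem eq_zero_of_ker_evalForms_eq_bot {σ ι : Type*} {P : ι → σ → ℂ} {k : ℕ}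
    (h : LinearMap.ker (evalForms P k) = ⊥) {f : MvPolynomial σ ℂ} (hf : f.IsHomogeneous k)
    (hP : ∀ i, eval (P i) f = 0) : f = 0 := by
  have : (⟨f, hf⟩ : homogeneousSubmodule σ ℂ k) ∈ LinearMap.ker (evalForms P k) := by
    ext i
    simp [hP]
  rw [h] at this
  exact congrArg Subtype.val ((Submodule.mem_bot ℂ).mp this)

theorem exists_sum_smul_pderiv_eq_zero {σ ι : Type*} [Fintype σ] {P : ι → σ → ℂ}
    {g : MvPolynomial σ ℂ} {k : ℕ} (hg : g.IsHomogeneous (k + 1))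
    (hP : ∀ i j, eval (P i) (pderiv j g) = 0)
    (h : Module.finrank ℂ (LinearMap.ker (evalForms P k)) < Fintype.card σ) :
    ∃ v : σ → ℂ, v ≠ 0 ∧ ∑ j, v j • pderiv j g = 0 := by
  have := finiteDimensional_homogeneousSubmodule σ k
  let D (j : σ) : LinearMap.ker (evalForms P k) :=
    ⟨⟨pderiv j g, hg.pderiv⟩, by ext i; simp [hP]⟩
  obtain ⟨v, hv, hv0⟩ := Submodule.exists_mem_ne_zero_of_ne_bot
    (LinearMap.ker_ne_bot_of_finrank_lt (f := Fintype.linearCombination ℂ D) (by simpa using h))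
  refine ⟨v, hv0, ?_⟩
  rw [LinearMap.mem_ker, Fintype.linearCombination_apply] at hv
  simpa [D] using congrArg (fun x : LinearMap.ker (evalForms P k) => (x : MvPolynomial σ ℂ)) hv

theorem MvPolynomial.pderiv_pderiv_comm {R σ : Type*} [CommRing R] (i j : σ)
    (f : MvPolynomial σ R) : pderiv i (pderiv j f) = pderiv j (pderiv i f) := by
  classical
  have h : ⁅(pderiv i : Derivation R (MvPolynomial σ R) (MvPolynomial σ R)),
      (pderiv j : Derivation R (MvPolynomial σ R) (MvPolynomial σ R))⁆ = 0 := by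
    refine MvPolynomial.derivation_ext fun k => ?_
    simp [Derivation.commutator_apply, pderiv_X, Pi.single_apply, apply_ite]
  exact sub_eq_zero.mp (DFunLike.congr_fun h f)

theorem Polynomial.two_mul_card_le_natDegree {K : Type*} [Field K] {p : Polynomial K}
    (hp : p ≠ 0) {T : Finset K} (h : ∀ a ∈ T, p.IsRoot a ∧ (derivative p).IsRoot a) :
    2 * T.card ≤ p.natDegree := by
  classical
  refine le_trans ?_ p.card_roots'
  rw [two_mul, ← Finset.card_val, ← Multiset.card_add]
  refine Multiset.card_le_card (Multiset.le_iff_count.mpr fun a => ?_)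
  rw [Multiset.count_add, count_roots]
  by_cases ha : a ∈ T
  · rw [Multiset.count_eq_one_of_mem T.nodup ha]
    exact (one_lt_rootMultiplicity_iff_isRoot hp).mpr (h a ha)
  · simp [Multiset.count_eq_zero_of_notMem (s := T.val) ha]

theorem eq_zero_of_forall_pderiv_vanish {ι : Type*} [Finite ι] {P : ι → Fin 3 → ℂ} {e : ℕ}
    (he : 1 ≤ e) {g : MvPolynomial (Fin 3) ℂ} (hg : g.IsHomogeneous (e + 2))
    (hP : ∀ i, eval (P i) g = 0) (hdP : ∀ i j, eval (P i) (pderiv j g) = 0)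
    (hlow : ∀ k ≤ e, LinearMap.ker (evalForms P k) = ⊥)
    (htwo : Module.finrank ℂ (LinearMap.ker (evalForms P (e + 1))) ≤ 2) : g = 0 := by
  classical
  have := Fintype.ofFinite ι
  obtain ⟨v, hv, hvg⟩ := exists_sum_smul_pderiv_eq_zero hg hdP
    (htwo.trans_lt (by simp))
  have hinv : ∀ x (t : ℂ), eval (x + t • v) g = eval x g :=
    eval_add_smul_of_sum_pderiv_eq_zero hvg
  have hdinv : ∀ j x (t : ℂ), eval (x + t • v) (pderiv j g) = eval x (pderiv j g) := by
    refine fun j => eval_add_smul_of_sum_pderiv_eq_zero ?_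
    have h := congrArg (pderiv j) hvg
    simp only [map_sum, map_zero] at h
    rw [← h]
    refine Finset.sum_congr rfl fun i _ => ?_
    rw [Derivation.map_smul, pderiv_pderiv_comm]
  obtain ⟨a, b, u, w, hau, haw, hbu, hbw, hspan, hdec⟩ :=
    (Submodule.span ℂ {v}).exists_coordinates_of_finrank_eq_add_two
      (by rw [finrank_span_singleton hv]; simp)
  obtain ⟨s, hs⟩ : ∃ s : ℂ, ∀ i, P i ∉ Submodule.span ℂ {v} → a (P i) + s * b (P i) ≠ 0 := by
    obtain ⟨s, hs⟩ := Infinite.exists_notMem_finset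
      (Finset.univ.image fun i => - a (P i) / b (P i))
    refine ⟨s, fun i hi h => ?_⟩
    by_cases hb : b (P i) = 0
    · rw [hb, mul_zero, add_zero] at h
      exact hi (by simpa [h, hb] using hdec (P i))
    · refine hs (Finset.mem_image.mpr ⟨i, Finset.mem_univ _, ?_⟩)
      rw [div_eq_iff hb]
      linear_combination -h
  set α := a + s • b with hα
  set w' := w - s • u with hw'
  have hαw : α w' = 0 := by simp [hα, hw', hau, haw, hbu, hbw]
  have hbw' : b w' = 1 := by simp [hw', hbu, hbw]
  have hαspan : ∀ y ∈ Submodule.span ℂ {v}, α y = 0 := fun y hy => by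
    simp [hα, hspan y hy]
  have hαP : ∀ i, P i ∉ Submodule.span ℂ {v} → α (P i) ≠ 0 := hs
  have hline : ∀ x, α x ≠ 0 → ∃ t : ℂ, x = α x • (u + (b x / α x) • w') + t • v := by
    intro x hx
    obtain ⟨t, ht⟩ := Submodule.mem_span_singleton.mp (hdec x)
    refine ⟨t, ?_⟩
    rw [ht, smul_add, smul_smul, mul_div_cancel₀ _ hx]
    simp only [hα, hw', LinearMap.add_apply, LinearMap.smul_apply, smul_eq_mul]
    module
  have hlineEval : ∀ {f : MvPolynomial (Fin 3) ℂ} {k : ℕ}, f.IsHomogeneous k →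
      (∀ x (t : ℂ), eval (x + t • v) f = eval x f) → ∀ x, α x ≠ 0 →
      eval x f = α x ^ k * eval (u + (b x / α x) • w') f := by
    intro f k hf hfv x hx
    obtain ⟨t, ht⟩ := hline x hx
    conv_lhs => rw [ht, hfv, hf.eval_smul]
  have hlin : linearForm α ≠ 0 := by
    intro h
    have := eval_linearForm α u
    rw [h] at this
    simp [hα, hau, hbu] at this
  let T : Finset ℂ := (Finset.univ.filter fun i => P i ∉ Submodule.span ℂ {v}).image
    fun i => b (P i) / α (P i)
  have hTne : T.card ≠ 0 := by
    intro hT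
    rw [Finset.card_eq_zero, Finset.image_eq_empty, Finset.filter_eq_empty_iff] at hT
    refine hlin (eq_zero_of_ker_evalForms_eq_bot (hlow 1 he) (linearForm_isHomogeneous α) ?_)
    intro i
    rw [eval_linearForm]
    exact hαspan _ (not_not.mp (hT (Finset.mem_univ i)))
  have hTcard : e < T.card := by
    by_contra! hle
    let q : MvPolynomial (Fin 3) ℂ := ∏ r ∈ T, linearForm (b - r • α)
    have hqhom : q.IsHomogeneous T.card := by
      have := IsHomogeneous.prod T (fun r => linearForm (b - r • α)) (fun _ => 1)
        fun r _ => linearForm_isHomogeneous _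
      rwa [Finset.sum_const, smul_eq_mul, mul_one] at this
    have hq0 : q = 0 := by
      refine eq_zero_of_ker_evalForms_eq_bot (hlow _ hle) hqhom fun i => ?_
      rw [map_prod, Finset.prod_eq_zero_iff]
      by_cases hi : P i ∈ Submodule.span ℂ {v}
      · obtain ⟨r, hr⟩ := Finset.card_ne_zero.mp hTne
        exact ⟨r, hr, by simp [hspan _ hi, hαspan _ hi]⟩
      · refine ⟨b (P i) / α (P i), Finset.mem_image_of_mem _ (by simpa using hi), ?_⟩
        simp [div_mul_cancel₀ _ (hαP i hi)]
    have := congrArg (eval w') hq0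
    simp [q, map_prod, hbw', hαw] at this
  have hG : lineRestriction u w' g = 0 := by
    by_contra hG
    have h := Polynomial.two_mul_card_le_natDegree hG (T := T) ?_
    · have := natDegree_lineRestriction_le u w' hg
      omega
    · intro r hr
      obtain ⟨i, hi, rfl⟩ := Finset.mem_image.mp hr
      have hi : α (P i) ≠ 0 := hαP i (Finset.mem_filter.mp hi).2
      have hz : ∀ {f : MvPolynomial (Fin 3) ℂ} {k : ℕ}, f.IsHomogeneous k →
          (∀ x (t : ℂ), eval (x + t • v) f = eval x f) → eval (P i) f = 0 →
          eval (u + (b (P i) / α (P i)) • w') f = 0 := by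
        intro f k hf hfv h0
        rw [hlineEval hf hfv _ hi] at h0
        exact (mul_eq_zero.mp h0).resolve_left (pow_ne_zero _ hi)
      constructor
      · rw [Polynomial.IsRoot, eval_lineRestriction]
        exact hz hg hinv (hP i)
      · rw [Polynomial.IsRoot, derivative_lineRestriction, Polynomial.eval_finsetSum]
        refine Finset.sum_eq_zero fun j _ => ?_
        rw [Polynomial.eval_mul, eval_lineRestriction, hz hg.pderiv (hdinv j) (hdP i j), zero_mul]
  refine (mul_eq_zero.mp (?_ : linearForm α * g = 0)).resolve_left hlin
  refine MvPolynomial.funext fun x => ?_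
  rw [map_mul, eval_linearForm, map_zero, mul_eq_zero]
  by_cases hx : α x = 0
  · exact Or.inl hx
  · rw [hlineEval hg hinv x hx, ← eval_lineRestriction, hG]
    simp

theorem finrank_homogeneousSubmodule_le (n k : ℕ) :
    Module.finrank ℂ (homogeneousSubmodule (Fin n) ℂ k) ≤ (n + k - 1).choose k := by
  let S := (Finset.univ : Finset (Fin n)).finsuppAntidiag k
  let A : homogeneousSubmodule (Fin n) ℂ k →ₗ[ℂ] S → ℂ :=
    LinearMap.pi fun m => (lcoeff ℂ (m : Fin n →₀ ℕ)).domRestrict _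
  have hA : Function.Injective A := by
    rw [injective_iff_map_eq_zero]
    intro f hf
    ext m
    by_cases hm : m.degree = k
    · have : m ∈ S := by
        simpa [S, Finset.mem_finsuppAntidiag, Finsupp.degree_eq_sum] using hm
      exact congrFun hf ⟨m, this⟩
    · exact IsHomogeneous.coeff_eq_zero f.2 hm
  have h := LinearMap.finrank_le_finrank_of_injective hA
  rwa [Module.finrank_fintype_fun_eq_card, Fintype.card_coe,
    Finset.card_finsuppAntidiag_nat_eq_choose, Finset.card_univ, Fintype.card_fin] at h

section Evaluation

variable {σ ι : Type*} [Fintype ι]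

theorem mem_ker_pointFunctional {P : ι → σ → ℂ} {k : ℕ} {c : ι → ℂ} :
    c ∈ LinearMap.ker (pointFunctional P k) ↔
      ∀ g : MvPolynomial σ ℂ, g.IsHomogeneous k → ∑ i, c i * eval (P i) g = 0 := by
  rw [LinearMap.mem_ker]
  refine ⟨fun h g hg => ?_, fun h => eq_zero_of_mem_gradedDual
    (pointFunctional_mem_gradedDual P k c) fun g hg => ?_⟩
  · rw [← pointFunctional_apply P c hg, h]; rfl
  · rw [pointFunctional_apply P c hg, h g hg]

theorem finrank_range_evalForms_add [Finite σ] (P : ι → σ → ℂ) (k : ℕ) :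
    Module.finrank ℂ (LinearMap.range (evalForms P k)) +
      Module.finrank ℂ (LinearMap.ker (pointFunctional P k)) = Fintype.card ι := by
  classical
  have := finiteDimensional_homogeneousSubmodule σ k
  let B : homogeneousSubmodule σ ℂ k →ₗ[ℂ] (ι → ℂ) →ₗ[ℂ] ℂ :=
    dotProductBilin ℂ ℂ ∘ₗ evalForms P k
  have h1 : LinearMap.ker (evalForms P k) = LinearMap.ker B := by
    ext g
    simp only [LinearMap.mem_ker, B, LinearMap.comp_apply]
    refine ⟨fun h => by rw [h, map_zero], fun h => funext fun i => ?_⟩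
    simpa using LinearMap.congr_fun h (Pi.single i 1)
  have h2 : LinearMap.ker (pointFunctional P k) = LinearMap.ker B.flip := by
    ext c
    rw [mem_ker_pointFunctional, LinearMap.mem_ker, LinearMap.ext_iff, Subtype.forall]
    simp [B, dotProduct, mul_comm]
  rw [LinearMap.finrank_range_eq_of_ker_eq h1, ← finrank_range_flip, h2,
    LinearMap.finrank_range_add_finrank_ker, Module.finrank_fintype_fun_eq_card]

theorem finrank_span_range_add (P : ι → σ → ℂ) :
    Module.finrank ℂ (Submodule.span ℂ (Set.range P)) +
      Module.finrank ℂ (LinearMap.ker (pointFunctional P 1)) = Fintype.card ι := by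
  have h : LinearMap.ker (pointFunctional P 1) =
      LinearMap.ker (Fintype.linearCombination ℂ P) := by
    ext c
    rw [LinearMap.mem_ker, LinearMap.mem_ker, Fintype.linearCombination_apply]
    constructor
    · intro h
      ext q
      rw [← LinearMap.mem_ker, mem_ker_pointFunctional] at h
      simpa using h (X q) (isHomogeneous_X ℂ q)
    · intro h
      refine eq_zero_of_polyAct_X_eq_zero (pointFunctional_mem_gradedDual P 1 c) fun q => ?_
      rw [polyAct_pointFunctional P (add_zero 1) c (isHomogeneous_X ℂ q), ← LinearMap.mem_ker,
        mem_ker_pointFunctional]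
      intro g hg
      rw [← totalDegree_zero_iff_isHomogeneous, totalDegree_eq_zero_iff_eq_C] at hg
      rw [hg]
      have := congrFun h q
      simp only [eval_X, eval_C, ← Finset.sum_mul]
      simp only [Finset.sum_apply, Pi.smul_apply, smul_eq_mul, Pi.zero_apply] at this
      rw [this, zero_mul]
  rw [h, ← Fintype.range_linearCombination ℂ P, LinearMap.finrank_range_add_finrank_ker,
    Module.finrank_fintype_fun_eq_card]

end Evaluation

section Pullback

variable {m n : ℕ}

/-- The pullback of polynomials along a linear map. -/
noncomputable def linearPullback (L : (Fin n → ℂ) →ₗ[ℂ] Fin m → ℂ) :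
    MvPolynomial (Fin m) ℂ →ₐ[ℂ] MvPolynomial (Fin n) ℂ :=
  aeval fun j => linearForm (LinearMap.proj j ∘ₗ L)

@[simp] theorem eval_linearPullback (L : (Fin n → ℂ) →ₗ[ℂ] Fin m → ℂ) (x : Fin n → ℂ)
    (f : MvPolynomial (Fin m) ℂ) : eval x (linearPullback L f) = eval (L x) f := by
  rw [← aeval_eq_eval, ← aeval_eq_eval, linearPullback]
  change (aeval x).comp (aeval _) f = _
  rw [comp_aeval]
  congr 2
  ext j
  simp [aeval_eq_eval]

theorem linearPullback_isHomogeneous (L : (Fin n → ℂ) →ₗ[ℂ] Fin m → ℂ)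
    {f : MvPolynomial (Fin m) ℂ} {k : ℕ} (hf : f.IsHomogeneous k) :
    (linearPullback L f).IsHomogeneous k := by
  have := hf.aeval (fun j => linearForm (LinearMap.proj j ∘ₗ L))
    fun j => linearForm_isHomogeneous _
  rwa [one_mul] at this

theorem eval_pderiv_linearPullback_eq_zero {L : (Fin n → ℂ) →ₗ[ℂ] Fin m → ℂ} {x : Fin n → ℂ}
    {f : MvPolynomial (Fin m) ℂ} (h : ∀ j, eval (L x) (pderiv j f) = 0) (k : Fin n) :
    eval x (pderiv k (linearPullback L f)) = 0 := by
  have := derivation_aeval (pderiv k) (fun j => linearForm (LinearMap.proj j ∘ₗ L)) f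
  rw [linearPullback, this, map_sum]
  refine Finset.sum_eq_zero fun j _ => ?_
  rw [map_mul]
  have h' := eval_linearPullback L x (pderiv j f)
  rw [h j, linearPullback] at h'
  rw [h', zero_mul]

theorem ker_pointFunctional_le {ι : Type*} [Fintype ι] {P : ι → Fin n → ℂ} {P' : ι → Fin m → ℂ}
    (L : (Fin n → ℂ) →ₗ[ℂ] Fin m → ℂ) (h : ∀ i, L (P i) = P' i) (k : ℕ) :
    LinearMap.ker (pointFunctional P k) ≤ LinearMap.ker (pointFunctional P' k) := by
  intro c hc
  rw [mem_ker_pointFunctional] at hc ⊢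
  intro g hg
  simpa [h] using hc _ (linearPullback_isHomogeneous L hg)

/-- A polynomial vanishing on a linear subspace of codimension two lies in the ideal generated by
two independent linear forms. -/
theorem exists_mem_span_of_vanish {Y : Submodule ℂ (Fin n → ℂ)}
    (hY : n = Module.finrank ℂ Y + 2) {f : MvPolynomial (Fin n) ℂ}
    (hf : ∀ y ∈ Y, eval y f = 0) :
    ∃ l₁ l₂ : MvPolynomial (Fin n) ℂ, l₁.IsHomogeneous 1 ∧ l₂.IsHomogeneous 1 ∧
      LinearIndependent ℂ ![l₁, l₂] ∧ f ∈ Ideal.span {l₁, l₂} := by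
  obtain ⟨l₁, l₂, a₁, a₂, h11, h12, h21, h22, -, hdec⟩ :=
    Y.exists_coordinates_of_finrank_eq_add_two (by simpa using hY)
  refine ⟨linearForm l₁, linearForm l₂, linearForm_isHomogeneous _, linearForm_isHomogeneous _,
    ?_, ?_⟩
  · rw [LinearIndependent.pair_iff]
    intro s t hst
    have h1 := congrArg (eval a₁) hst
    have h2 := congrArg (eval a₂) hst
    simp only [map_add, smul_eval, eval_linearForm, h11, h12, h21, h22, map_zero] at h1 h2
    exact ⟨by simpa using h1, by simpa using h2⟩
  · let I := Ideal.span {linearForm l₁, linearForm l₂}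
    let π : (Fin n → ℂ) →ₗ[ℂ] Fin n → ℂ :=
      LinearMap.id - l₁.smulRight a₁ - l₂.smulRight a₂
    have hπ : linearPullback π f = 0 := MvPolynomial.funext fun x => by
      rw [eval_linearPullback, map_zero]
      exact hf _ (hdec x)
    have hmk : (Ideal.Quotient.mkₐ ℂ I).comp (linearPullback π) = Ideal.Quotient.mkₐ ℂ I := by
      refine MvPolynomial.algHom_ext fun j => ?_
      have : linearForm (LinearMap.proj j ∘ₗ π) =
          X j - a₁ j • linearForm l₁ - a₂ j • linearForm l₂ := MvPolynomial.funext fun x => by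
        simp [π, mul_comm]
      rw [AlgHom.comp_apply, linearPullback, aeval_X, this, Ideal.Quotient.mkₐ_eq_mk,
        Ideal.Quotient.eq]
      have h1 : linearForm l₁ ∈ I := Ideal.subset_span (by simp)
      have h2 : linearForm l₂ ∈ I := Ideal.subset_span (by simp)
      rw [show X j - a₁ j • linearForm l₁ - a₂ j • linearForm l₂ - X j =
        -(C (a₁ j) * linearForm l₁ + C (a₂ j) * linearForm l₂) by
          simp only [smul_eq_C_mul]; ring]
      exact I.neg_mem (I.add_mem (I.mul_mem_left _ h1) (I.mul_mem_left _ h2))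
    have h := DFunLike.congr_fun hmk f
    rw [AlgHom.comp_apply, hπ, map_zero, Ideal.Quotient.mkₐ_eq_mk] at h
    exact Ideal.Quotient.eq_zero_iff_mem.mp h.symm

end Pullback

theorem vanish_on_span_of_forall_pderiv_vanish {ι : Type*} [Fintype ι] {n e : ℕ} (he : 1 ≤ e)
    {P : ι → Fin n → ℂ} (hcard : Fintype.card ι = (e + 1) ^ 2)
    (hker : ∀ k, pointRelations P (k + 1) = LinearMap.ker (pointFunctional P k))
    (hrel : ∀ k ≤ 2 * e, Module.finrank ℂ (pointRelations P k) =
      Module.finrank ℂ (pointRelations P (k + 1)) + (min k (2 * e - k) + 1))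
    {f : MvPolynomial (Fin n) ℂ} (hf : f.IsHomogeneous (e + 2)) (hP : ∀ i, eval (P i) f = 0)
    (hdP : ∀ i j, eval (P i) (pderiv j f) = 0) :
    Module.finrank ℂ (Submodule.span ℂ (Set.range P)) = 3 ∧
      ∀ y ∈ Submodule.span ℂ (Set.range P), eval y f = 0 := by
  have hzero : Module.finrank ℂ (pointRelations P 0) = Fintype.card ι := by
    rw [pointRelations_zero, finrank_top]; simp
  have hpascal : ∀ k, (k + 1 + 2).choose 2 = (k + 2).choose 2 + (k + 2) := fun k => by
    rw [Nat.choose_succ_succ' (k + 2) 1, Nat.choose_one_right, add_comm]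
  have hchoose : ∀ k ≤ e, (k + 2).choose 2 + Module.finrank ℂ (LinearMap.ker (pointFunctional P k)) =
      Fintype.card ι := by
    intro k hk
    rw [← hker]
    induction k with
    | zero => have := hrel 0 (by omega); simp at this ⊢; omega
    | succ k ih =>
      have h1 := ih (by omega)
      have h2 := hrel (k + 1) (by omega)
      have := hpascal k
      omega
  have hY : Module.finrank ℂ (Submodule.span ℂ (Set.range P)) = 3 := by
    have h1 := hchoose 1 he
    have h2 := finrank_span_range_add P
    norm_num [Nat.choose] at h1
    omega
  refine ⟨hY, ?_⟩
  set Y := Submodule.span ℂ (Set.range P)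
  let T : (Fin 3 → ℂ) →ₗ[ℂ] Fin n → ℂ :=
    Y.subtype ∘ₗ (Module.finBasisOfFinrankEq ℂ Y hY).equivFun.symm
  have hT : LinearMap.range T = Y := by
    rw [LinearMap.range_comp, LinearEquiv.range, Submodule.map_top, Submodule.range_subtype]
  obtain ⟨S, hS⟩ := T.exists_leftInverse_of_injective (LinearMap.ker_eq_bot.mpr
    (Y.injective_subtype.comp (LinearEquiv.injective _)))
  have hTS : ∀ i, T (S (P i)) = P i := by
    intro i
    obtain ⟨z, hz⟩ : P i ∈ LinearMap.range T := hT ▸ Submodule.subset_span ⟨i, rfl⟩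
    rw [← hz, ← LinearMap.comp_apply S, hS, LinearMap.id_apply]
  have hkereq : ∀ k, LinearMap.ker (pointFunctional (fun i => S (P i)) k) =
      LinearMap.ker (pointFunctional P k) := fun k =>
    le_antisymm (ker_pointFunctional_le T hTS k) (ker_pointFunctional_le S (fun _ => rfl) k)
  have hev : ∀ k, Module.finrank ℂ (LinearMap.ker (evalForms (fun i => S (P i)) k)) +
      Fintype.card ι ≤ (k + 2).choose 2 + Module.finrank ℂ (LinearMap.ker (pointFunctional P k)) := by
    intro k
    have := finiteDimensional_homogeneousSubmodule (Fin 3) k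
    have h1 := finrank_range_evalForms_add (fun i => S (P i)) k
    have h2 := LinearMap.finrank_range_add_finrank_ker (evalForms (fun i => S (P i)) k)
    have h3 := finrank_homogeneousSubmodule_le 3 k
    rw [show 3 + k - 1 = k + 2 by omega, Nat.choose_symm_add] at h3
    rw [hkereq] at h1
    omega
  have hpull : linearPullback T f = 0 := by
    refine eq_zero_of_forall_pderiv_vanish he (P := fun i => S (P i))
      (linearPullback_isHomogeneous T hf) (fun i => by simp [hTS, hP])
      (fun i => eval_pderiv_linearPullback_eq_zero (by simpa only [hTS] using hdP i))
      (fun k hk => ?_) ?_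
    · have := finiteDimensional_homogeneousSubmodule (Fin 3) k
      rw [← Submodule.finrank_eq_zero (R := ℂ)]
      have := hev k
      have := hchoose k hk
      omega
    · have h1 := hev (e + 1)
      have h2 := hchoose e le_rfl
      have h3 := hrel (e + 1) (by omega)
      rw [← hker] at h1 h2
      have := hpascal e
      omega
  intro y hy
  obtain ⟨z, rfl⟩ : y ∈ LinearMap.range T := hT ▸ hy
  rw [← eval_linearPullback, hpull, map_zero]

theorem finrank_range_evalForms_le_hilb {m : ℕ} {Sig : Set (Projectivization ℂ (Fin m → ℂ))}
    {ι : Type*} {P : ι → Fin m → ℂ} (hP : ∀ i, ∃ p ∈ Sig, ∃ t : ℂ, P i = t • p.rep) (k : ℕ) :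
    Module.finrank ℂ (LinearMap.range (evalForms P k)) ≤
      hilb m (coneVanishingIdeal m Sig) k := by
  have := finiteDimensional_homogeneousSubmodule (Fin m) k
  have hle : Submodule.comap (homogeneousSubmodule (Fin m) ℂ k).subtype
      (Submodule.restrictScalars ℂ (coneVanishingIdeal m Sig)) ≤
      LinearMap.ker (evalForms P k) := by
    intro g hg
    rw [Submodule.mem_comap, Submodule.restrictScalars_mem] at hg
    ext i
    obtain ⟨p, hp, t, ht⟩ := hP i
    have hvan : coneVanishingIdeal m Sig ≤ RingHom.ker (eval (P i)) :=
      Ideal.span_le.mpr fun g hg => by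
        rw [SetLike.mem_coe, RingHom.mem_ker, ht]
        exact hg p hp t
    simpa using hvan hg
  rw [← Submodule.range_liftQ _ _ hle]
  exact LinearMap.finrank_range_le _

/-- a nodal hypersurface `X = V(f) ⊂ ℙ^4` of degree `d ≥ 3` with defect
and exactly `(d-1)^2` nodes contains a plane, i.e. `f` lies in the ideal generated by
two linearly independent linear forms. -/
theorem nodal_threefold_defect_min_nodes_contains_plane (d : ℕ) (hd : 3 ≤ d)
    (f : MvPolynomial (Fin 5) ℂ) (hf0 : f ≠ 0) (hf : f.IsHomogeneous d)
    (hnodal : IsNodal 5 f)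
    (hdefect : hilb 5 (coneVanishingIdeal 5 (singLocus 5 f)) (2 * d - 5) <
      (singLocus 5 f).ncard)
    (hcard : (singLocus 5 f).ncard = (d - 1) ^ 2) :
    ∃ l₁ l₂ : MvPolynomial (Fin 5) ℂ, l₁.IsHomogeneous 1 ∧ l₂.IsHomogeneous 1 ∧
      LinearIndependent ℂ ![l₁, l₂] ∧ f ∈ Ideal.span {l₁, l₂} := by
  obtain ⟨e, rfl⟩ : ∃ e, d = e + 2 := ⟨d - 2, by omega⟩
  have he : 1 ≤ e := by omega
  rw [show e + 2 - 1 = e + 1 by omega] at hcard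
  rw [show 2 * (e + 2) - 5 = 2 * e - 1 by omega] at hdefect
  have hfin : (singLocus 5 f).Finite := Set.finite_of_ncard_ne_zero (by rw [hcard]; positivity)
  let _ : Fintype (singLocus 5 f) := hfin.fintype
  have hcard' : Fintype.card (singLocus 5 f) = (singLocus 5 f).ncard := by
    rw [← Nat.card_eq_fintype_card, Nat.card_coe_set_eq]
  obtain ⟨α, hα⟩ := Module.exists_dual_forall_apply_ne_zero (K := ℂ)
    (fun p : singLocus 5 f => p.1.rep) fun p => p.1.rep_nonzero
  let P (p : singLocus 5 f) : Fin 5 → ℂ := (α p.1.rep)⁻¹ • p.1.rep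
  have hαP : ∀ p, eval (P p) (linearForm α) = 1 := fun p => by
    simp [P, inv_mul_cancel₀ (hα p)]
  have hinj : Function.Injective P := by
    intro p q hpq
    refine Subtype.ext ?_
    rw [← p.1.mk_rep, ← q.1.mk_rep, Projectivization.mk_eq_mk_iff']
    refine ⟨α p.1.rep * (α q.1.rep)⁻¹, ?_⟩
    rw [mul_smul]
    change α p.1.rep • P q = _
    rw [← hpq, smul_inv_smul₀ (hα p)]
  have hdP : ∀ p j, eval (P p) (pderiv j f) = 0 := fun p j => by
    rw [hf.pderiv.eval_smul, p.2 j, mul_zero]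
  have hP : ∀ p, eval (P p) f = 0 := by
    intro p
    have h := congrArg (eval (P p)) hf.sum_X_mul_pderiv
    rw [map_sum, Finset.sum_eq_zero fun j _ => by rw [map_mul, hdP, mul_zero], map_nsmul] at h
    exact (smul_eq_zero.mp h.symm).resolve_left (by omega)
  have hbpf : ∀ x : Fin 5 → ℂ, x ≠ 0 → (∀ g : MvPolynomial (Fin 5) ℂ, g.IsHomogeneous (e + 1) →
      (∀ p, eval (P p) g = 0) → eval x g = 0) → eval x (linearForm α) ≠ 0 := by
    intro x hx h
    obtain ⟨a, ha⟩ := Projectivization.exists_smul_eq_mk_rep ℂ x hx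
    have hmem : Projectivization.mk ℂ x hx ∈ singLocus 5 f := by
      intro j
      rw [← ha, Units.smul_def, hf.pderiv.eval_smul, h _ hf.pderiv fun p => hdP p j, mul_zero]
    have hne := hα ⟨_, hmem⟩
    rw [← ha, Units.smul_def, map_smul] at hne
    rw [eval_linearForm]
    exact right_ne_zero_of_mul hne
  have hker := pointRelations_succ_eq_ker (linearForm_isHomogeneous α) hαP
  have hdef : pointRelations P (2 * e) ≠ ⊥ := by
    intro h
    rw [show 2 * e = 2 * e - 1 + 1 by omega, hker] at h
    have h1 := finrank_range_evalForms_add P (2 * e - 1)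
    have h2 := finrank_range_evalForms_le_hilb (P := P)
      (fun p => ⟨p.1, p.2, _, rfl⟩) (2 * e - 1)
    rw [h, finrank_bot] at h1
    omega
  obtain ⟨hY, hvan⟩ := vanish_on_span_of_forall_pderiv_vanish he (hcard'.trans hcard) hker
    (fun k hk => finrank_pointRelations (hcard'.trans hcard) hinj (linearForm_isHomogeneous α)
      hαP hbpf hdef hk) hf hP hdP
  exact exists_mem_span_of_vanish (by rw [hY]) hvan
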